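/- arXiv:2507.10987 — 3 statements merged into one kernel-verified Lean document; each statement's English description precedes it below -/
import Mathlib

section
/- Let j ≥ 1 and let s_0, ..., s_{2j} be Hermitian q×q complex matrices such that H_{1,j-1} and H_{2,j-1} are positive definite. Then for every z ∈ ℂ: P_{1,j}(z)·Q_{2,j}^♯(z) − z·Q_{1,j}(z)·P_{2,j}^♯(z) = s_{2j} − Y_{1,j}^* H_{1,j-1}^{-1} Y_{1,j}. -/
open Matrix MeasureTheory
open scoped ComplexOrder

noncomputable section

/-- The space of `q × q` complex matrices. -/
abbrev Mat (q : ℕ) := Matrix (Fin q) (Fin q) ℂ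

/-- The h-part of an even-degree matrix polynomial
`f(z) = A 0 * z^(2m) + ... + A (2m)`:  `h(z) = A 0 * z^m + A 2 * z^(m-1) + ... + A (2m)`. -/
def hEven (q m : ℕ) (A : ℕ → Mat q) (z : ℂ) : Mat q :=
  ∑ j ∈ Finset.range (m + 1), z ^ (m - j) • A (2 * j)

/-- The g-part of an even-degree matrix polynomial:
`g(z) = A 1 * z^(m-1) + A 3 * z^(m-2) + ... + A (2m-1)`. -/
def gEven (q m : ℕ) (A : ℕ → Mat q) (z : ℂ) : Mat q :=
  ∑ j ∈ Finset.range m, z ^ (m - 1 - j) • A (2 * j + 1)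

/-- The h-part of an odd-degree matrix polynomial
`f(z) = A 0 * z^(2m+1) + ... + A (2m+1)`:  `h(z) = A 1 * z^m + ... + A (2m+1)`. -/
def hOdd (q m : ℕ) (A : ℕ → Mat q) (z : ℂ) : Mat q :=
  ∑ j ∈ Finset.range (m + 1), z ^ (m - j) • A (2 * j + 1)

/-- The g-part of an odd-degree matrix polynomial: `g(z) = A 0 * z^m + ... + A (2m)`. -/
def gOdd (q m : ℕ) (A : ℕ → Mat q) (z : ℂ) : Mat q :=
  ∑ j ∈ Finset.range (m + 1), z ^ (m - j) • A (2 * j)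

/-- The matrix polynomial `f(z) = A 0 * z^n + A 1 * z^(n-1) + ... + A n`. -/
def fPoly (q n : ℕ) (A : ℕ → Mat q) (z : ℂ) : Mat q :=
  ∑ j ∈ Finset.range (n + 1), z ^ (n - j) • A j

/-- Continued fraction for the even case:  `wEven q m c d j z = w_{m-1-j}(z)`, where
`w_{m-1}(z) = z c_{m-1} + d_{m-1}⁻¹` and `w_k(z) = z c_k + (d_k + w_{k+1}(z)⁻¹)⁻¹`. -/
def wEven (q m : ℕ) (c d : ℕ → Mat q) : ℕ → ℂ → Mat q
  | 0, z => z • c (m - 1) + (d (m - 1))⁻¹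
  | j + 1, z => z • c (m - 2 - j) + (d (m - 2 - j) + (wEven q m c d j z)⁻¹)⁻¹

/-- Continued fraction for the odd case:  `wOdd q m c d j z = w_{m-1-j}(z)`, where
`w_{m-1}(z) = z c_{m-1} + (d_{m-1} + z⁻¹ c_m⁻¹)⁻¹`. -/
def wOdd (q m : ℕ) (c d : ℕ → Mat q) : ℕ → ℂ → Mat q
  | 0, z => z • c (m - 1) + (d (m - 1) + z⁻¹ • (c m)⁻¹)⁻¹
  | j + 1, z => z • c (m - 2 - j) + (d (m - 2 - j) + (wOdd q m c d j z)⁻¹)⁻¹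

/-- A Hurwitz-type matrix polynomial of degree 2m, described through its h-part and g-part:
there are Hermitian positive definite matrices `c_0, ..., c_{m-1}`, `d_0, ..., d_{m-1}` with
`g(z) h(z)⁻¹ = w_0(z)⁻¹` whenever `det (h z) ≠ 0` and all inverses in the recursion exist. -/
def IsHTMEven (q m : ℕ) (h g : ℂ → Mat q) : Prop :=
  ∃ c d : ℕ → Mat q,
    (∀ k < m, (c k).PosDef) ∧ (∀ k < m, (d k).PosDef) ∧
    ∀ z : ℂ, (h z).det ≠ 0 →
      (∀ j < m, IsUnit (wEven q m c d j z).det) →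
      (∀ j, j + 1 < m → IsUnit (d (m - 2 - j) + (wEven q m c d j z)⁻¹).det) →
      g z * (h z)⁻¹ = (wEven q m c d (m - 1) z)⁻¹

/-- A Hurwitz-type matrix polynomial of degree 2m+1, described through its h-part and g-part:
there are Hermitian positive definite matrices `c_0, ..., c_m`, `d_0, ..., d_{m-1}` with
`h(z) (z g(z))⁻¹ = w_0(z)⁻¹` whenever `z ≠ 0`, `det (g z) ≠ 0` and all inverses exist. -/
def IsHTMOdd (q m : ℕ) (h g : ℂ → Mat q) : Prop :=
  ∃ c d : ℕ → Mat q,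
    (∀ k ≤ m, (c k).PosDef) ∧ (∀ k < m, (d k).PosDef) ∧
    ∀ z : ℂ, z ≠ 0 → (g z).det ≠ 0 →
      IsUnit (d (m - 1) + z⁻¹ • (c m)⁻¹).det →
      (∀ j < m, IsUnit (wOdd q m c d j z).det) →
      (∀ j, j + 1 < m → IsUnit (d (m - 2 - j) + (wOdd q m c d j z)⁻¹).det) →
      h z * (z • g z)⁻¹ = (wOdd q m c d (m - 1) z)⁻¹

/-- `s_0, ..., s_{2m-1}` are Markov parameters of the even-degree polynomial with
coefficients `A`:  `z^(2m) g(z) - (∑_{j<2m} (-1)^j s_j z^(2m-1-j)) h(z)` has degree ≤ m-1. -/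
def MarkovEven (q m : ℕ) (A s : ℕ → Mat q) : Prop :=
  ∃ B : ℕ → Mat q, ∀ z : ℂ,
    z ^ (2 * m) • gEven q m A z
      - (∑ j ∈ Finset.range (2 * m), ((-1 : ℂ) ^ j * z ^ (2 * m - 1 - j)) • s j) * hEven q m A z
    = ∑ k ∈ Finset.range m, z ^ k • B k

/-- `s_0, ..., s_{2m}` are Markov parameters of the odd-degree polynomial with coefficients
`A`:  `z^(2m+1) h(z) - (∑_{j≤2m} (-1)^j s_j z^(2m-j)) z g(z)` has degree ≤ m. -/
def MarkovOdd (q m : ℕ) (A s : ℕ → Mat q) : Prop :=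
  ∃ B : ℕ → Mat q, ∀ z : ℂ,
    z ^ (2 * m + 1) • hOdd q m A z
      - (∑ j ∈ Finset.range (2 * m + 1), ((-1 : ℂ) ^ j * z ^ (2 * m - j)) • s j) *
          (z • gOdd q m A z)
    = ∑ k ∈ Finset.range (m + 1), z ^ k • B k

/-- The block Hankel matrix `H_{1,n-1} = (s_{i+j})_{i,j=0}^{n-1}` with `n` block rows. -/
def H1b (q : ℕ) (s : ℕ → Mat q) (n : ℕ) : Matrix (Fin n × Fin q) (Fin n × Fin q) ℂ :=
  Matrix.of fun p r => s ((p.1 : ℕ) + (r.1 : ℕ)) p.2 r.2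

/-- The block Hankel matrix `H_{2,n-1} = (s_{i+j+1})_{i,j=0}^{n-1}` with `n` block rows. -/
def H2b (q : ℕ) (s : ℕ → Mat q) (n : ℕ) : Matrix (Fin n × Fin q) (Fin n × Fin q) ℂ :=
  Matrix.of fun p r => s ((p.1 : ℕ) + (r.1 : ℕ) + 1) p.2 r.2

/-- The block column `Y_{1,n} = (s_n; s_{n+1}; ...; s_{2n-1})`. -/
def Y1b (q : ℕ) (s : ℕ → Mat q) (n : ℕ) : Matrix (Fin n × Fin q) (Fin q) ℂ :=
  Matrix.of fun p b => s (n + (p.1 : ℕ)) p.2 b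

/-- The block column `Y_{2,n} = (s_{n+1}; ...; s_{2n})`. -/
def Y2b (q : ℕ) (s : ℕ → Mat q) (n : ℕ) : Matrix (Fin n × Fin q) (Fin q) ℂ :=
  Matrix.of fun p b => s (n + 1 + (p.1 : ℕ)) p.2 b

/-- The block column `col (I, z I, ..., z^(n-1) I)`. -/
def colPow (q n : ℕ) (z : ℂ) : Matrix (Fin n × Fin q) (Fin q) ℂ :=
  Matrix.of fun p b => z ^ (p.1 : ℕ) * (if p.2 = b then 1 else 0)

/-- `r_i(z) = ∑_{k=1}^{i} z^(i-k) s_{k-1}`. -/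
def rPol (q : ℕ) (s : ℕ → Mat q) (i : ℕ) (z : ℂ) : Mat q :=
  ∑ k ∈ Finset.range i, z ^ (i - 1 - k) • s k

/-- `t_i(z) = ∑_{k=0}^{i} z^(i-k) s_k`. -/
def tPol (q : ℕ) (s : ℕ → Mat q) (i : ℕ) (z : ℂ) : Mat q :=
  ∑ k ∈ Finset.range (i + 1), z ^ (i - k) • s k

/-- The block column `col (r_0(z), ..., r_{n-1}(z))`. -/
def colR (q : ℕ) (s : ℕ → Mat q) (n : ℕ) (z : ℂ) : Matrix (Fin n × Fin q) (Fin q) ℂ :=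
  Matrix.of fun p b => rPol q s (p.1 : ℕ) z p.2 b

/-- The block column `col (t_0(z), ..., t_{n-1}(z))`. -/
def colT (q : ℕ) (s : ℕ → Mat q) (n : ℕ) (z : ℂ) : Matrix (Fin n × Fin q) (Fin q) ℂ :=
  Matrix.of fun p b => tPol q s (p.1 : ℕ) z p.2 b

/-- `P_{1,j}(z) = z^j I - Y_{1,j}^* H_{1,j-1}⁻¹ col(I, zI, ..., z^(j-1) I)`. -/
def P1 (q : ℕ) (s : ℕ → Mat q) (j : ℕ) (z : ℂ) : Mat q :=
  z ^ j • (1 : Mat q) - (Y1b q s j)ᴴ * (H1b q s j)⁻¹ * colPow q j z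

/-- `P_{2,j}(z) = z^j I - Y_{2,j}^* H_{2,j-1}⁻¹ col(I, zI, ..., z^(j-1) I)`. -/
def P2 (q : ℕ) (s : ℕ → Mat q) (j : ℕ) (z : ℂ) : Mat q :=
  z ^ j • (1 : Mat q) - (Y2b q s j)ᴴ * (H2b q s j)⁻¹ * colPow q j z

/-- `Q_{1,j}(z) = r_j(z) - Y_{1,j}^* H_{1,j-1}⁻¹ col(r_0(z), ..., r_{j-1}(z))`. -/
def Q1 (q : ℕ) (s : ℕ → Mat q) (j : ℕ) (z : ℂ) : Mat q :=
  rPol q s j z - (Y1b q s j)ᴴ * (H1b q s j)⁻¹ * colR q s j z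

/-- `Q_{2,j}(z) = t_j(z) - Y_{2,j}^* H_{2,j-1}⁻¹ col(t_0(z), ..., t_{j-1}(z))`. -/
def Q2 (q : ℕ) (s : ℕ → Mat q) (j : ℕ) (z : ℂ) : Mat q :=
  tPol q s j z - (Y2b q s j)ᴴ * (H2b q s j)⁻¹ * colT q s j z

/-- The block column `e = (I; 0; ...; 0)` with `n` blocks. -/
def eCol (q n : ℕ) : Matrix (Fin n × Fin q) (Fin q) ℂ :=
  Matrix.of fun p b => if (p.1 : ℕ) = 0 then (if p.2 = b then 1 else 0) else 0

/-- The block column `y = (s_0; s_1; ...; s_{n-1})`. -/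
def yCol (q : ℕ) (s : ℕ → Mat q) (n : ℕ) : Matrix (Fin n × Fin q) (Fin q) ℂ :=
  Matrix.of fun p b => s (p.1 : ℕ) p.2 b

/-- Condition C: `A_i^* A_k = A_k^* A_i` for every odd `i` and even `k` with `i, k ≤ n`. -/
def CondC (q n : ℕ) (A : ℕ → Mat q) : Prop :=
  ∀ i k, i ≤ n → k ≤ n → i % 2 = 1 → k % 2 = 0 → (A i)ᴴ * A k = (A k)ᴴ * A i

/-- The symmetrizer: for a polynomial with (descending) coefficients `Q_0, ..., Q_{n-1}`
(read off as `Q_j = A (2j)`), the `n × n` block Hankel matrix whose `(i,k)` block is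
`A (2(n-1-i-k))` if `i + k ≤ n - 1`, and `0` otherwise. -/
def Sh (q n : ℕ) (A : ℕ → Mat q) : Matrix (Fin n × Fin q) (Fin n × Fin q) ℂ :=
  Matrix.of fun p r =>
    if (p.1 : ℕ) + (r.1 : ℕ) ≤ n - 1 then A (2 * (n - 1 - (p.1 : ℕ) - (r.1 : ℕ))) p.2 r.2
    else 0

/-- The signature matrix `J̃ = diag (I, -I, I, ..., ±I)` with `n` blocks. -/
def Jt (q n : ℕ) : Matrix (Fin n × Fin q) (Fin n × Fin q) ℂ :=
  Matrix.diagonal (fun p => (-1 : ℂ) ^ (p.1 : ℕ))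

/-- The block row `(I, x² I, ..., x^(2n-2) I)`. -/
def Rev (q n : ℕ) (x : ℂ) : Matrix (Fin q) (Fin n × Fin q) ℂ :=
  Matrix.of fun a p => x ^ (2 * (p.1 : ℕ)) * (if a = p.2 then 1 else 0)

/-- The block column `(I; y² I; ...; y^(2n-2) I)`. -/
def Cev (q n : ℕ) (y : ℂ) : Matrix (Fin n × Fin q) (Fin q) ℂ :=
  Matrix.of fun p b => y ^ (2 * (p.1 : ℕ)) * (if p.2 = b then 1 else 0)

/-- The block row `(x I, x³ I, ..., x^(2n-1) I)`. -/
def Rod (q n : ℕ) (x : ℂ) : Matrix (Fin q) (Fin n × Fin q) ℂ :=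
  Matrix.of fun a p => x ^ (2 * (p.1 : ℕ) + 1) * (if a = p.2 then 1 else 0)

/-- The block column `(y I; y³ I; ...; y^(2n-1) I)`. -/
def Cod (q n : ℕ) (y : ℂ) : Matrix (Fin n × Fin q) (Fin q) ℂ :=
  Matrix.of fun p b => y ^ (2 * (p.1 : ℕ) + 1) * (if p.2 = b then 1 else 0)

open Finset in
/-- A matrix polynomial expression `g n - A * col (g 0, ..., g (n-1))` is a monic block
combination of `g 0, ..., g n`, with coefficients depending only on `A`. -/
lemma exists_monic_coeffs {q n : ℕ} (A : Matrix (Fin q) (Fin n × Fin q) ℂ) :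
    ∃ p : ℕ → Mat q, p n = 1 ∧ ∀ g : ℕ → Mat q,
      g n - A * (Matrix.of fun (x : Fin n × Fin q) b => g (x.1 : ℕ) x.2 b)
        = ∑ i ∈ range (n + 1), p i * g i := by
  refine ⟨fun i => if h : i < n then -(Matrix.of fun a b => A a (⟨i, h⟩, b)) else 1,
    by simp, fun g => ?_⟩
  rw [sum_range_succ, sum_range]
  simp only [Fin.is_lt, dif_pos, lt_irrefl, dif_neg, not_false_eq_true, one_mul, neg_mul,
    sum_neg_distrib, Fin.eta]
  rw [sub_eq_neg_add]
  congr 2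
  ext a b
  simp [Matrix.mul_apply, Matrix.sum_apply, Fintype.sum_prod_type]

open Finset in
/-- Both sides are differences of partial sums of `m ↦ z ^ m • s (i + l - m)`. -/
lemma pow_smul_tPol_sub {q : ℕ} (s : ℕ → Mat q) (i l : ℕ) (z : ℂ) :
    z ^ i • tPol q s l z - z ^ (l + 1) • rPol q s i z
      = ∑ m ∈ range (l + 1), z ^ m • s (i + (l - m))
        - ∑ m ∈ range i, z ^ m • s (l + (i - 1 - m) + 1) := by
  have ht : z ^ i • tPol q s l z
      = ∑ m ∈ range (l + 1), z ^ (i + m) • s (i + l - (i + m)) := by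
    rw [tPol, ← sum_range_reflect, smul_sum]
    refine sum_congr rfl fun m hm => ?_
    have hm := mem_range.1 hm
    rw [smul_smul, ← pow_add]
    congr 2 <;> [congr 1; skip] <;> omega
  have hr : z ^ (l + 1) • rPol q s i z
      = ∑ m ∈ range i, z ^ (l + 1 + m) • s (i + l - (l + 1 + m)) := by
    rw [rPol, ← sum_range_reflect, smul_sum]
    refine sum_congr rfl fun m hm => ?_
    have hm := mem_range.1 hm
    rw [smul_smul, ← pow_add]
    congr 2 <;> [congr 1; skip] <;> omega
  have hl : ∑ m ∈ range (l + 1), z ^ m • s (i + (l - m))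
      = ∑ m ∈ range (l + 1), z ^ m • s (i + l - m) := by
    refine sum_congr rfl fun m hm => ?_
    have hm := mem_range.1 hm
    congr 2; omega
  have hi : ∑ m ∈ range i, z ^ m • s (l + (i - 1 - m) + 1)
      = ∑ m ∈ range i, z ^ m • s (i + l - m) := by
    refine sum_congr rfl fun m hm => ?_
    have hm := mem_range.1 hm
    congr 2; omega
  have e1 := sum_range_add (fun m => z ^ m • s (i + l - m)) i (l + 1)
  have e2 := sum_range_add (fun m => z ^ m • s (i + l - m)) (l + 1) i
  rw [ht, hr, hl, hi, sub_eq_sub_iff_add_eq_add, add_comm, ← e1, ← e2, add_comm i]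

open Finset in
/-- Christoffel–Darboux type evaluation for block coefficients `p`, `c` that are orthogonal to
the moments `s` and to the shifted moments, respectively. -/
lemma sum_mul_tPol_sub_sum_rPol_mul {q j : ℕ} (s p c : ℕ → Mat q) (hc : c j = 1)
    (hp : ∀ k < j, ∑ i ∈ range (j + 1), p i * s (i + k) = 0)
    (hs : ∀ k < j, ∑ l ∈ range (j + 1), s (l + k + 1) * c l = 0) (z : ℂ) :
    (∑ i ∈ range (j + 1), p i * z ^ i • (1 : Mat q))
          * (∑ l ∈ range (j + 1), tPol q s l z * c l)
        - z • ((∑ i ∈ range (j + 1), p i * rPol q s i z)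
          * ∑ l ∈ range (j + 1), z ^ l • (1 : Mat q) * c l)
      = ∑ i ∈ range (j + 1), p i * s (i + j) := by
  have key : (∑ i ∈ range (j + 1), p i * z ^ i • (1 : Mat q))
          * (∑ l ∈ range (j + 1), tPol q s l z * c l)
        - z • ((∑ i ∈ range (j + 1), p i * rPol q s i z)
          * ∑ l ∈ range (j + 1), z ^ l • (1 : Mat q) * c l)
      = ∑ i ∈ range (j + 1), ∑ l ∈ range (j + 1),
          p i * (z ^ i • tPol q s l z - z ^ (l + 1) • rPol q s i z) * c l := by
    rw [sum_mul_sum, sum_mul_sum, smul_sum, ← sum_sub_distrib]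
    refine sum_congr rfl fun i _ => ?_
    rw [smul_sum, ← sum_sub_distrib]
    refine sum_congr rfl fun l _ => ?_
    simp only [mul_sub, sub_mul, mul_smul_comm, smul_mul_assoc, mul_one, one_mul, smul_smul,
      mul_assoc, pow_succ']
  have hfst : ∑ i ∈ range (j + 1), ∑ l ∈ range (j + 1),
      p i * (∑ m ∈ range (l + 1), z ^ m • s (i + (l - m))) * c l
      = ∑ i ∈ range (j + 1), p i * s (i + j) := by
    have h (l : ℕ) : ∑ i ∈ range (j + 1),
          p i * (∑ m ∈ range (l + 1), z ^ m • s (i + (l - m))) * c l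
        = ∑ m ∈ range (l + 1), z ^ m • ((∑ i ∈ range (j + 1), p i * s (i + (l - m))) * c l) := by
      simp only [mul_sum, sum_mul, smul_sum, mul_smul_comm, smul_mul_assoc]
      exact sum_comm
    rw [sum_comm, sum_congr rfl fun l _ => h l, sum_range_succ, sum_eq_zero, zero_add,
      sum_range_succ', sum_eq_zero]
    · simp [hc]
    · intro m hm
      rw [hp _ (by have := mem_range.1 hm; omega), zero_mul, smul_zero]
    · intro l hl
      refine sum_eq_zero fun m _ => ?_
      rw [hp _ (by have := mem_range.1 hl; omega), zero_mul, smul_zero]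
  have hsnd : ∑ i ∈ range (j + 1), ∑ l ∈ range (j + 1),
      p i * (∑ m ∈ range i, z ^ m • s (l + (i - 1 - m) + 1)) * c l = 0 := by
    refine sum_eq_zero fun i hi => ?_
    have h : ∑ l ∈ range (j + 1), p i * (∑ m ∈ range i, z ^ m • s (l + (i - 1 - m) + 1)) * c l
        = ∑ m ∈ range i,
            z ^ m • (p i * ∑ l ∈ range (j + 1), s (l + (i - 1 - m) + 1) * c l) := by
      simp only [mul_sum, sum_mul, smul_sum, mul_smul_comm, smul_mul_assoc, mul_assoc]
      exact sum_comm
    rw [h]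
    refine sum_eq_zero fun m hm => ?_
    rw [hs _ (by have := mem_range.1 hm; have := mem_range.1 hi; omega), mul_zero, smul_zero]
  rw [key]
  simp only [pow_smul_tPol_sub, mul_sub, sub_mul, sum_sub_distrib]
  rw [hfst, hsnd, sub_zero]

lemma tPol_star_conjTranspose {q l : ℕ} {s : ℕ → Mat q} (h : ∀ k ≤ l, (s k).IsHermitian)
    (z : ℂ) : (tPol q s l ((starRingEnd ℂ) z))ᴴ = tPol q s l z := by
  rw [tPol, tPol, Matrix.conjTranspose_sum]
  refine Finset.sum_congr rfl fun k hk => ?_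
  rw [Matrix.conjTranspose_smul, (h k (by have := Finset.mem_range.1 hk; omega)).eq]
  simp

theorem stmt_1 (q j : ℕ) (hq : 1 ≤ q) (hj : 1 ≤ j) (s : ℕ → Mat q)
    (hherm : ∀ i ≤ 2 * j, (s i).IsHermitian)
    (h1 : (H1b q s j).PosDef) (h2 : (H2b q s j).PosDef) :
    ∀ z : ℂ,
      P1 q s j z * (Q2 q s j ((starRingEnd ℂ) z))ᴴ
        - z • (Q1 q s j z * (P2 q s j ((starRingEnd ℂ) z))ᴴ)
      = s (2 * j) - (Y1b q s j)ᴴ * (H1b q s j)⁻¹ * Y1b q s j := by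
  intro z
  obtain ⟨p, -, hp⟩ := exists_monic_coeffs ((Y1b q s j)ᴴ * (H1b q s j)⁻¹)
  obtain ⟨b, hb1, hb⟩ := exists_monic_coeffs ((Y2b q s j)ᴴ * (H2b q s j)⁻¹)
  have colPow_eq (w : ℂ) : colPow q j w
      = Matrix.of fun (x : Fin j × Fin q) b => (w ^ (x.1 : ℕ) • (1 : Mat q)) x.2 b := by
    ext x b
    simp [colPow, Matrix.one_apply]
  have hP1 : P1 q s j z = ∑ i ∈ Finset.range (j + 1), p i * z ^ i • (1 : Mat q) := by
    rw [P1, colPow_eq, ← hp fun i => z ^ i • (1 : Mat q)]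
  have hQ1 : Q1 q s j z = ∑ i ∈ Finset.range (j + 1), p i * rPol q s i z :=
    hp fun i => rPol q s i z
  have hP2 : (P2 q s j ((starRingEnd ℂ) z))ᴴ
      = ∑ l ∈ Finset.range (j + 1), z ^ l • (1 : Mat q) * (b l)ᴴ := by
    rw [P2, colPow_eq, hb fun i => (starRingEnd ℂ) z ^ i • (1 : Mat q),
      Matrix.conjTranspose_sum]
    simp [Matrix.conjTranspose_smul]
  have hQ2 : (Q2 q s j ((starRingEnd ℂ) z))ᴴ
      = ∑ l ∈ Finset.range (j + 1), tPol q s l z * (b l)ᴴ := by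
    rw [show Q2 q s j ((starRingEnd ℂ) z) = _ from hb fun i => tPol q s i ((starRingEnd ℂ) z),
      Matrix.conjTranspose_sum]
    refine Finset.sum_congr rfl fun l hl => ?_
    rw [Matrix.conjTranspose_mul, tPol_star_conjTranspose]
    exact fun k hk => hherm k (by have := Finset.mem_range.1 hl; omega)
  have hA1 : (Y1b q s j)ᴴ * (H1b q s j)⁻¹ * H1b q s j = (Y1b q s j)ᴴ := by
    rw [Matrix.mul_assoc, Matrix.nonsing_inv_mul _ ((Matrix.isUnit_iff_isUnit_det _).1 h1.isUnit),
      Matrix.mul_one]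
  have hA2 : (Y2b q s j)ᴴ * (H2b q s j)⁻¹ * H2b q s j = (Y2b q s j)ᴴ := by
    rw [Matrix.mul_assoc, Matrix.nonsing_inv_mul _ ((Matrix.isUnit_iff_isUnit_det _).1 h2.isUnit),
      Matrix.mul_one]
  have orth1 : ∀ k < j, ∑ i ∈ Finset.range (j + 1), p i * s (i + k) = 0 := by
    intro k hk
    rw [← hp fun i => s (i + k), sub_eq_zero]
    ext a c
    have h := congrFun (congrFun hA1 a) (⟨k, hk⟩, c)
    have e := congrFun (congrFun (hherm (j + k) (by omega)).eq a) c
    rw [← e]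
    exact h.symm
  have orth2 : ∀ k < j, ∑ l ∈ Finset.range (j + 1), s (l + k + 1) * (b l)ᴴ = 0 := by
    intro k hk
    have h0 : ∑ l ∈ Finset.range (j + 1), b l * s (l + k + 1) = 0 := by
      rw [← hb fun i => s (i + k + 1), sub_eq_zero]
      ext a c
      have h := congrFun (congrFun hA2 a) (⟨k, hk⟩, c)
      have e := congrFun (congrFun (hherm (j + 1 + k) (by omega)).eq a) c
      rw [show j + k + 1 = j + 1 + k by omega, ← e]
      exact h.symm
    have h := congrArg Matrix.conjTranspose h0
    rw [Matrix.conjTranspose_sum, Matrix.conjTranspose_zero] at h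
    rw [← h]
    refine Finset.sum_congr rfl fun l hl => ?_
    rw [Matrix.conjTranspose_mul,
      (hherm (l + k + 1) (by have := Finset.mem_range.1 hl; omega)).eq]
  rw [hP1, hQ1, hP2, hQ2,
    sum_mul_tPol_sub_sum_rPol_mul s p (fun l => (b l)ᴴ) (by simp [hb1]) orth1 orth2,
    ← hp fun i => s (i + j), two_mul]
  simp only [Y1b, add_comm j]

end
end

section
/- Let f be a Hurwitz-type matrix (HTM) polynomial of degree 2m. Then there exist Hermitian q×q matrices s_0, ..., s_{2m-1} such that the matrix polynomial z^{2m}·g(z) − (Σ_{j=0}^{2m-1} (−1)^j s_j z^{2m-1-j})·h(z) has degree at most m−1 (i.e., f possesses Hermitian Markov parameters). -/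
open Matrix MeasureTheory
open scoped ComplexOrder

noncomputable section

open Filter Topology

theorem hEven_eq_leading_add (q m : ℕ) (A : ℕ → Mat q) (z : ℂ) :
    hEven q m A z = z ^ m • A 0 + ∑ k ∈ Finset.range m, z ^ k • A (2 * (m - k)) := by
  rw [hEven, Finset.sum_range_succ', add_comm, ← Finset.sum_range_reflect]
  congr 1
  refine Finset.sum_congr rfl fun k hk => ?_
  have := Finset.mem_range.1 hk
  congr 2 <;> congr 1 <;> omega

theorem exists_descending_quotient (q m : ℕ) (hm : 1 ≤ m) (A : ℕ → Mat q)
    (hA0 : (A 0).det ≠ 0) (n : ℕ) :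
    ∃ t B : ℕ → Mat q, ∀ z : ℂ, z ^ n • gEven q m A z =
      (∑ j ∈ Finset.range n, z ^ (n - 1 - j) • t j) * hEven q m A z
        + ∑ k ∈ Finset.range m, z ^ k • B k := by
  obtain ⟨p, rfl⟩ : ∃ p, m = p + 1 := ⟨m - 1, by omega⟩
  induction n with
  | zero =>
    refine ⟨0, fun k => A (2 * (p - k) + 1), fun z => ?_⟩
    rw [gEven, ← Finset.sum_range_reflect]
    simp only [pow_zero, one_smul, Finset.range_zero, Finset.sum_empty, zero_mul, zero_add]
    refine Finset.sum_congr rfl fun k hk => ?_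
    have := Finset.mem_range.1 hk
    congr 2
    omega
  | succ n ih =>
    obtain ⟨t, B, h⟩ := ih
    set u : Mat q := B p * (A 0)⁻¹ with hu
    refine ⟨fun j => if j < n then t j else u,
      fun k => (if k = 0 then 0 else B (k - 1)) - u * A (2 * (p + 1 - k)), fun z => ?_⟩
    have hA : u * A 0 = B p := by
      rw [hu, mul_assoc, Matrix.nonsing_inv_mul _ (isUnit_iff_ne_zero.2 hA0), mul_one]
    have hQ : ∑ j ∈ Finset.range (n + 1), z ^ (n + 1 - 1 - j) • (if j < n then t j else u)
        = z • (∑ j ∈ Finset.range n, z ^ (n - 1 - j) • t j) + u := by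
      rw [Finset.sum_range_succ, Finset.smul_sum]
      congr 1
      · refine Finset.sum_congr rfl fun j hj => ?_
        have := Finset.mem_range.1 hj
        rw [if_pos this, smul_smul, ← pow_succ']
        congr 2
        omega
      · simp
    have hR : z • ∑ k ∈ Finset.range (p + 1), z ^ k • B k
        = (∑ k ∈ Finset.range (p + 1), z ^ k • (if k = 0 then 0 else B (k - 1)))
          + z ^ (p + 1) • B p := by
      rw [Finset.sum_range_succ, smul_add, smul_smul, ← pow_succ', Finset.sum_range_succ',
        Finset.smul_sum]
      simp [smul_smul, pow_succ']
    rw [pow_succ', mul_smul, h, smul_add, hQ, add_mul, smul_mul_assoc, hR]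
    simp only [smul_sub, Finset.sum_sub_distrib]
    have hU : u * hEven q (p + 1) A z = z ^ (p + 1) • B p
        + ∑ k ∈ Finset.range (p + 1), z ^ k • (u * A (2 * (p + 1 - k))) := by
      rw [hEven_eq_leading_add, mul_add, mul_smul_comm, hA, Finset.mul_sum]
      simp only [mul_smul_comm]
    rw [hU]
    abel

theorem wEven_posDef (q m : ℕ) (c d : ℕ → Mat q) (hc : ∀ k < m, (c k).PosDef)
    (hd : ∀ k < m, (d k).PosDef) {x : ℝ} (hx : 0 < x) (j : ℕ) (hj : j < m) :
    (wEven q m c d j (x : ℂ)).PosDef := by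
  have hx' : (0 : ℂ) < x := by exact_mod_cast hx
  induction j with
  | zero => exact ((hc _ (by omega)).smul hx').add (hd _ (by omega)).inv
  | succ j ih =>
    exact ((hc _ (by omega)).smul hx').add ((hd _ (by omega)).add (ih (by omega)).inv).inv

theorem isHermitian_div_of_isHTMEven {q m : ℕ} (hm : 1 ≤ m) {h g : ℂ → Mat q}
    (hHTM : IsHTMEven q m h g) {x : ℝ} (hx : 0 < x) (hdet : (h x).det ≠ 0) :
    (g x * (h x)⁻¹).IsHermitian := by
  obtain ⟨c, d, hc, hd, H⟩ := hHTM
  have hw := wEven_posDef q m c d hc hd hx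
  rw [H x hdet (fun j hj => (Matrix.isUnit_iff_isUnit_det _).1 (hw j hj).isUnit)
    fun j hj => (Matrix.isUnit_iff_isUnit_det _).1
      ((hd _ (by omega)).add (hw j (by omega)).inv).isUnit]
  exact (hw (m - 1) (by omega)).inv.isHermitian

theorem tendsto_inv_pow_mul_pow {k m : ℕ} (hk : k < m) :
    Tendsto (fun x : ℝ => ((x : ℂ) ^ m)⁻¹ * (x : ℂ) ^ k) atTop (𝓝 0) := by
  have h1 : Tendsto (fun x : ℝ => (x ^ (m - k))⁻¹) atTop (𝓝 0) :=
    (tendsto_pow_atTop (by omega)).inv_tendsto_atTop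
  have h2 := (Complex.continuous_ofReal.tendsto 0).comp h1
  rw [Complex.ofReal_zero] at h2
  refine h2.congr' ?_
  filter_upwards [eventually_gt_atTop 0] with x hx
  have hx' : (x : ℂ) ≠ 0 := by exact_mod_cast hx.ne'
  obtain ⟨l, rfl⟩ : ∃ l, m = k + l := ⟨m - k, by omega⟩
  simp only [Function.comp, Nat.add_sub_cancel_left, Complex.ofReal_inv, Complex.ofReal_pow,
    pow_add]
  field_simp

theorem tendsto_inv_pow_smul_sum (q m : ℕ) (B : ℕ → Mat q) :
    Tendsto (fun x : ℝ => ((x : ℂ) ^ m)⁻¹ • ∑ k ∈ Finset.range m, (x : ℂ) ^ k • B k)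
      atTop (𝓝 0) := by
  simp only [Finset.smul_sum, smul_smul]
  rw [show (0 : Mat q) = ∑ k ∈ Finset.range m, (0 : ℂ) • B k by simp]
  exact tendsto_finsetSum _ fun k hk =>
    (tendsto_inv_pow_mul_pow (Finset.mem_range.1 hk)).smul_const _

theorem tendsto_inv_pow_smul_hEven (q m : ℕ) (A : ℕ → Mat q) :
    Tendsto (fun x : ℝ => ((x : ℂ) ^ m)⁻¹ • hEven q m A x) atTop (𝓝 (A 0)) := by
  have h := (tendsto_inv_pow_smul_sum q m fun k => A (2 * (m - k))).add_const (A 0)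
  rw [zero_add] at h
  refine h.congr' ?_
  filter_upwards [eventually_gt_atTop 0] with x hx
  have hx' : (x : ℂ) ≠ 0 := by exact_mod_cast hx.ne'
  rw [hEven_eq_leading_add, smul_add, smul_smul, inv_mul_cancel₀ (pow_ne_zero _ hx'), one_smul,
    add_comm]

theorem coeff_eq_zero_of_tendsto_zero (n : ℕ) (a : ℕ → ℂ)
    (h : Tendsto (fun x : ℝ => ∑ j ∈ Finset.range n, (x : ℂ) ^ (n - 1 - j) * a j) atTop (𝓝 0))
    (j : ℕ) (hj : j < n) : a j = 0 := by
  set P : Polynomial ℂ :=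
    ∑ k ∈ Finset.range n, Polynomial.monomial k (a (n - 1 - k)) with hP
  have hev : ∀ x : ℂ, P.eval x = ∑ j ∈ Finset.range n, x ^ (n - 1 - j) * a j := by
    intro x
    rw [hP, Polynomial.eval_finsetSum, ← Finset.sum_range_reflect]
    refine Finset.sum_congr rfl fun k hk => ?_
    have := Finset.mem_range.1 hk
    rw [Polynomial.eval_monomial, mul_comm, show n - 1 - (n - 1 - k) = k by omega]
  simp only [← hev] at h
  have hdeg : P.degree ≤ 0 := by
    by_contra! hlt
    refine not_tendsto_nhds_of_tendsto_atTop
      (P.tendsto_norm_atTop hlt (z := fun x : ℝ => (x : ℂ)) ?_) _ h.norm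
    simpa using tendsto_abs_atTop_atTop
  rw [Polynomial.eq_C_of_degree_le_zero hdeg] at h
  simp only [Polynomial.eval_C] at h
  have h0 : P = 0 := by
    rw [Polynomial.eq_C_of_degree_le_zero hdeg, tendsto_nhds_unique tendsto_const_nhds h,
      Polynomial.C_0]
  have hc : P.coeff (n - 1 - j) = a j := by
    rw [hP, Polynomial.finsetSum_coeff, Finset.sum_eq_single_of_mem (n - 1 - j)
      (Finset.mem_range.2 (by omega))]
    · rw [Polynomial.coeff_monomial_same, show n - 1 - (n - 1 - j) = j by omega]
    · exact fun k _ hk => Polynomial.coeff_monomial_of_ne _ hk.symm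
  rw [← hc, h0, Polynomial.coeff_zero]

theorem isHermitian_of_quotient (q m n : ℕ) (hm : 1 ≤ m) (A t B : ℕ → Mat q)
    (hA0 : (A 0).det ≠ 0) (hHTM : IsHTMEven q m (hEven q m A) (gEven q m A))
    (hdiv : ∀ z : ℂ, z ^ n • gEven q m A z =
      (∑ j ∈ Finset.range n, z ^ (n - 1 - j) • t j) * hEven q m A z
        + ∑ k ∈ Finset.range m, z ^ k • B k) (j : ℕ) (hj : j < n) :
    (t j).IsHermitian := by
  have hlim := tendsto_inv_pow_smul_hEven q m A
  have hdet : ∀ᶠ x : ℝ in atTop, (hEven q m A x).det ≠ 0 := by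
    have hd := ((continuous_id.matrix_det).tendsto (A 0)).comp hlim
    filter_upwards [hd.eventually_ne hA0] with x hx h0
    exact hx (by simp [h0])
  have hinv : Tendsto (fun x : ℝ => (((x : ℂ) ^ m)⁻¹ • hEven q m A x)⁻¹) atTop
      (𝓝 (A 0)⁻¹) := by
    have hcont : ContinuousAt (fun M : Mat q => M⁻¹) (A 0) := by
      refine continuousAt_matrix_inv _ ?_
      simpa [Ring.inverse_eq_inv'] using continuousAt_inv₀ hA0
    exact hcont.tendsto.comp hlim
  set E : ℝ → Mat q := fun x =>
    (∑ k ∈ Finset.range m, (x : ℂ) ^ k • B k) * (hEven q m A x)⁻¹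
  have hE : Tendsto E atTop (𝓝 0) := by
    have h := (tendsto_inv_pow_smul_sum q m B).mul hinv
    rw [zero_mul] at h
    refine h.congr' ?_
    filter_upwards [hdet, eventually_gt_atTop 0] with x hx hpos
    have hx' : (x : ℂ) ^ m ≠ 0 := pow_ne_zero _ (by exact_mod_cast hpos.ne')
    have := invertibleOfNonzero (inv_ne_zero hx')
    rw [Matrix.inv_smul _ _ (isUnit_iff_ne_zero.2 hx), smul_mul_smul_comm, mul_invOf_self,
      one_smul]
  have hEH : Tendsto (fun x => (E x)ᴴ - E x) atTop (𝓝 0) := by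
    have h := ((continuous_id.matrix_conjTranspose).tendsto (0 : Mat q)).comp hE
    simpa using h.sub hE
  have hdiff : Tendsto (fun x : ℝ => ∑ j ∈ Finset.range n, (x : ℂ) ^ (n - 1 - j) •
      (t j - (t j)ᴴ)) atTop (𝓝 0) := by
    refine hEH.congr' ?_
    filter_upwards [hdet, eventually_gt_atTop 0] with x hx hpos
    have hherm := isHermitian_div_of_isHTMEven hm hHTM hpos hx
    have hquot : ∑ j ∈ Finset.range n, (x : ℂ) ^ (n - 1 - j) • t j
        = (x : ℂ) ^ n • (gEven q m A x * (hEven q m A x)⁻¹) - E x := by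
      rw [← smul_mul_assoc, hdiv, add_mul, mul_assoc,
        Matrix.mul_nonsing_inv _ (isUnit_iff_ne_zero.2 hx), mul_one, add_sub_cancel_right]
    have hconj : ∑ j ∈ Finset.range n, (x : ℂ) ^ (n - 1 - j) • (t j)ᴴ
        = (x : ℂ) ^ n • (gEven q m A x * (hEven q m A x)⁻¹) - (E x)ᴴ := by
      have h := congrArg Matrix.conjTranspose hquot
      rw [Matrix.conjTranspose_sub, Matrix.conjTranspose_smul, hherm.eq,
        Matrix.conjTranspose_sum] at h
      simpa [Matrix.conjTranspose_smul] using h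
    simp only [smul_sub, Finset.sum_sub_distrib]
    rw [hquot, hconj]
    abel
  have hzero : t j - (t j)ᴴ = 0 := by
    ext a b
    refine coeff_eq_zero_of_tendsto_zero n (fun j => (t j - (t j)ᴴ) a b) ?_ j hj
    have h := ((continuous_id.matrix_elem a b).tendsto (0 : Mat q)).comp hdiff
    refine h.congr fun x => ?_
    simp [Matrix.sum_apply]
  exact (sub_eq_zero.1 hzero).symm

theorem stmt_2 (q m : ℕ) (hq : 1 ≤ q) (hm : 1 ≤ m) (A : ℕ → Mat q)
    (hA0 : (A 0).det ≠ 0)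
    (hHTM : IsHTMEven q m (hEven q m A) (gEven q m A)) :
    ∃ s : ℕ → Mat q, (∀ j < 2 * m, (s j).IsHermitian) ∧ MarkovEven q m A s := by
  obtain ⟨t, B, hdiv⟩ := exists_descending_quotient q m hm A hA0 (2 * m)
  refine ⟨fun j => (-1 : ℂ) ^ j • t j, fun j hj => ?_, B, fun z => ?_⟩
  · have ht := isHermitian_of_quotient q m (2 * m) hm A t B hA0 hHTM hdiv j hj
    rw [Matrix.IsHermitian, Matrix.conjTranspose_smul, ht.eq]
    simp
  · rw [hdiv z, sub_eq_iff_eq_add, add_comm]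
    congr 2
    refine Finset.sum_congr rfl fun j _ => ?_
    rw [smul_smul, mul_right_comm, ← mul_pow]
    simp

end
end

section
/- Let f be a matrix polynomial of degree 2m with det A_0 ≠ 0, and suppose Hermitian q×q matrices s_0, ..., s_{2m-1} are Markov parameters of f. Then f is a Hurwitz-type matrix (HTM) polynomial if and only if the block Hankel matrices H_{1,m-1} = (s_{i+j})_{i,j=0}^{m-1} and H_{2,m-1} = (s_{i+j+1})_{i,j=0}^{m-1} are both positive definite. -/
open Matrix MeasureTheory
open scoped ComplexOrder

noncomputable section

theorem posDef_fromBlocks_iff {m n : Type*} [Fintype m] [Fintype n] [DecidableEq m]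
    [DecidableEq n] (A : Matrix m m ℂ) (B : Matrix m n ℂ) (D : Matrix n n ℂ) :
    (fromBlocks A B Bᴴ D).PosDef ↔ A.PosDef ∧ (D - Bᴴ * A⁻¹ * B).PosDef := by
  have key (hA : A.PosDef) :
      (fromBlocks A B Bᴴ D).PosDef ↔ (D - Bᴴ * A⁻¹ * B).PosDef := by
    have : Invertible A := hA.isUnit.invertible
    have h1 := PosDef.fromBlocks₁₁ B D hA
    have h2 := det_fromBlocks₁₁ A B Bᴴ D
    rw [invOf_eq_nonsing_inv] at h2
    constructor
    · intro h
      refine (h1.1 h.posSemidef).posDef_iff_det_ne_zero.2 fun h0 => ?_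
      exact h.det_pos.ne' (by rw [h2, h0, mul_zero])
    · intro h
      refine (h1.2 h.posSemidef).posDef_iff_det_ne_zero.2 ?_
      rw [h2]
      exact mul_ne_zero hA.det_pos.ne' h.det_pos.ne'
  constructor
  · intro h
    have hA : A.PosDef := h.submatrix (e := Sum.inl) Sum.inl_injective
    exact ⟨hA, (key hA).1 h⟩
  · rintro ⟨hA, h⟩
    exact (key hA).2 h

section Convolution

variable {R : Type*} [Ring R]

/-- The entries of the congruence of the Hankel matrix of `u` by the lower triangular Toeplitz
matrix of `s`, when `s * (a - X * u) = (a - X * u) * s = 1` as power series. -/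
theorem toeplitz_hankel_toeplitz_entry (s u : ℕ → R) (a : R) (h0 : a * s 0 = 1)
    (hr : ∀ n, ∑ i ∈ Finset.range (n + 1), s (n - i) * u i = s (n + 1) * a)
    (hl : ∀ n, ∑ i ∈ Finset.range (n + 1), u i * s (n - i) = a * s (n + 1)) (j : ℕ) :
    ∀ i, ∑ k ∈ Finset.range (i + 1), ∑ l ∈ Finset.range (j + 1),
      s (i - k) * u (k + l) * s (j - l) = s (i + j + 1) := by
  induction j with
  | zero =>
    intro i
    simp only [zero_add, Finset.range_one, Finset.sum_singleton, add_zero, Nat.sub_self]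
    rw [← Finset.sum_mul, hr, mul_assoc, h0, mul_one]
  | succ j ih =>
    intro i
    have h1 := ih (i + 1)
    rw [Finset.sum_range_succ'] at h1
    simp only [Nat.sub_zero, zero_add] at h1
    have h2 : ∑ l ∈ Finset.range (j + 1), s (i + 1) * u l * s (j - l)
        = s (i + 1) * a * s (j + 1) := by
      simp only [mul_assoc]
      rw [← Finset.mul_sum, hl]
    rw [h2] at h1
    have h3 : ∀ k, ∑ l ∈ Finset.range (j + 1 + 1), s (i - k) * u (k + l) * s (j + 1 - l)
        = (∑ l ∈ Finset.range (j + 1), s (i - k) * u (k + 1 + l) * s (j - l))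
          + s (i - k) * u k * s (j + 1) := by
      intro k
      rw [Finset.sum_range_succ']
      simp only [Nat.sub_zero, add_zero, Nat.add_sub_add_right]
      congr 1
      refine Finset.sum_congr rfl fun l _ => ?_
      rw [add_assoc k 1 l, add_comm 1 l]
    simp only [h3]
    rw [Finset.sum_add_distrib, ← Finset.sum_mul, hr]
    simp only [Nat.add_sub_add_right] at h1
    rw [h1]
    congr 1
    ring

theorem toeplitz_hankel_succ_toeplitz_entry (s u : ℕ → R) (a : R) (h0 : a * s 0 = 1)
    (hr : ∀ n, ∑ i ∈ Finset.range (n + 1), s (n - i) * u i = s (n + 1) * a)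
    (hl : ∀ n, ∑ i ∈ Finset.range (n + 1), u i * s (n - i) = a * s (n + 1)) (i j : ℕ) :
    ∑ k ∈ Finset.range (i + 1), ∑ l ∈ Finset.range (j + 1),
      s (i - k) * u (k + l + 1) * s (j - l)
      = s (i + j + 2) - s (i + 1) * a * s (j + 1) := by
  have h1 := toeplitz_hankel_toeplitz_entry s u a h0 hr hl j (i + 1)
  rw [Finset.sum_range_succ'] at h1
  simp only [Nat.sub_zero, zero_add] at h1
  have h2 : ∑ l ∈ Finset.range (j + 1), s (i + 1) * u l * s (j - l)
      = s (i + 1) * a * s (j + 1) := by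
    simp only [mul_assoc]
    rw [← Finset.mul_sum, hl]
  rw [h2] at h1
  simp only [Nat.add_sub_add_right] at h1
  rw [show i + j + 2 = i + 1 + j + 1 by ring, ← h1, add_sub_cancel_right]
  refine Finset.sum_congr rfl fun k _ => Finset.sum_congr rfl fun l _ => ?_
  rw [add_right_comm]

/-- The `n × n` Hankel matrix of a sequence. -/
def hankel (n : ℕ) (s : ℕ → R) : Matrix (Fin n) (Fin n) R :=
  Matrix.of fun i j => s ((i : ℕ) + j)

/-- The `n × n` lower triangular Toeplitz matrix of a sequence. -/
def lowerToeplitz (n : ℕ) (s : ℕ → R) : Matrix (Fin n) (Fin n) R :=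
  Matrix.of fun i j => if (j : ℕ) ≤ i then s (i - j) else 0

theorem sum_fin_ite_le {n : ℕ} (i : Fin n) (f : ℕ → R) :
    ∑ k : Fin n, (if (k : ℕ) ≤ i then f k else 0) = ∑ k ∈ Finset.range ((i : ℕ) + 1), f k := by
  rw [Fin.sum_univ_eq_sum_range (fun k => if k ≤ (i : ℕ) then f k else 0) n, ← Finset.sum_filter]
  congr 1
  ext k
  simp only [Finset.mem_filter, Finset.mem_range]
  have := i.2
  omega

theorem lowerToeplitz_mul_hankel_mul_apply (n : ℕ) (s t u : ℕ → R) (i j : Fin n) :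
    (lowerToeplitz n s * hankel n u * (lowerToeplitz n t)ᵀ) i j
      = ∑ k ∈ Finset.range ((i : ℕ) + 1), ∑ l ∈ Finset.range ((j : ℕ) + 1),
          s (i - k) * u (k + l) * t (j - l) := by
  rw [Finset.sum_comm, ← sum_fin_ite_le j, mul_apply]
  refine Finset.sum_congr rfl fun l _ => ?_
  rw [mul_apply, transpose_apply]
  simp only [lowerToeplitz, hankel, of_apply, ite_mul, zero_mul]
  rw [sum_fin_ite_le i (fun k => s (i - k) * u (k + l))]
  split_ifs
  · rw [Finset.sum_mul]
  · rw [mul_zero]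

theorem lowerToeplitz_mul_lowerToeplitz (n : ℕ) (s t : ℕ → R) :
    lowerToeplitz n s * lowerToeplitz n t
      = lowerToeplitz n fun k => ∑ l ∈ Finset.range (k + 1), s (k - l) * t l := by
  ext i j
  rw [mul_apply]
  simp only [lowerToeplitz, of_apply, ite_mul, zero_mul]
  rw [sum_fin_ite_le i (fun k => s (i - k) * if (j : ℕ) ≤ k then t (k - j) else 0)]
  split_ifs with h
  · symm
    refine Finset.sum_of_injOn (fun l => (j : ℕ) + l) ?_ ?_ ?_ ?_
    · intro a _ b _ hab
      simpa using hab
    · intro l hl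
      simp only [Finset.coe_range, Set.mem_Iio] at hl ⊢
      omega
    · intro k hk hk'
      rw [if_neg, mul_zero]
      intro hjk
      apply hk'
      refine ⟨k - j, ?_, ?_⟩
      · simp only [Finset.coe_range, Set.mem_Iio, Finset.mem_range] at hk ⊢
        omega
      · simp only
        omega
    · intro l _
      rw [if_pos (by omega)]
      congr 2
      · omega
      · omega
  · refine Finset.sum_eq_zero fun k hk => ?_
    rw [Finset.mem_range] at hk
    rw [if_neg (by omega), mul_zero]

end Convolution

section BlockHankel

variable {q : ℕ}

theorem H1b_eq_comp (s : ℕ → Mat q) (n : ℕ) :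
    H1b q s n = compRingEquiv (Fin n) (Fin q) ℂ (hankel n s) := rfl

theorem H2b_eq_comp (s : ℕ → Mat q) (n : ℕ) :
    H2b q s n = compRingEquiv (Fin n) (Fin q) ℂ (hankel n fun k => s (k + 1)) := rfl

/-- `s` and `u` are the coefficient sequences of power series related by
`s * (a - X * u) = (a - X * u) * s = 1`. -/
structure InvConv (s u : ℕ → Mat q) (a : Mat q) : Prop where
  mul_zero : s 0 * a = 1
  zero_mul : a * s 0 = 1
  right : ∀ n, ∑ i ∈ Finset.range (n + 1), s (n - i) * u i = s (n + 1) * a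
  left : ∀ n, ∑ i ∈ Finset.range (n + 1), u i * s (n - i) = a * s (n + 1)

theorem InvConv.isUnit_comp_lowerToeplitz {s u : ℕ → Mat q} {a : Mat q} (h : InvConv s u a)
    (n : ℕ) : IsUnit (compRingEquiv (Fin n) (Fin q) ℂ (lowerToeplitz n s)) := by
  let t : ℕ → Mat q := fun k => Nat.casesOn k a fun k => -u k
  have h1 : lowerToeplitz n s * lowerToeplitz n t = 1 := by
    rw [lowerToeplitz_mul_lowerToeplitz]
    ext1 i j
    have ht : ∀ k, ∑ l ∈ Finset.range (k + 1), s (k - l) * t l = if k = 0 then 1 else 0 := by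
      rintro (_ | k)
      · simpa [t] using h.mul_zero
      · rw [Finset.sum_range_succ']
        simp only [t, mul_neg, Finset.sum_neg_distrib, Nat.add_sub_add_right, Nat.sub_zero]
        rw [h.right]
        simp
    simp only [lowerToeplitz, of_apply, ht, one_apply]
    by_cases hij : i = j
    · simp [hij]
    · have : (i : ℕ) ≠ j := fun h => hij (Fin.ext h)
      rw [if_neg hij]
      split_ifs
      · omega
      · rfl
      · rfl
  have h2 := congrArg (compRingEquiv (Fin n) (Fin q) ℂ) h1
  rw [map_mul, map_one] at h2
  exact IsUnit.of_mul_eq_one _ h2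

theorem star_comp_lowerToeplitz {s : ℕ → Mat q} (hs : ∀ n, (s n).IsHermitian) (n : ℕ) :
    star (compRingEquiv (Fin n) (Fin q) ℂ (lowerToeplitz n s))
      = compRingEquiv (Fin n) (Fin q) ℂ (lowerToeplitz n s)ᵀ := by
  ext ⟨i, k⟩ ⟨j, l⟩
  simp only [star_apply, compRingEquiv_apply, comp_apply, transpose_apply, lowerToeplitz,
    of_apply]
  split_ifs
  · exact (hs _).apply _ _
  · simp

theorem InvConv.posDef_H2b_iff {s u : ℕ → Mat q} {a : Mat q} (h : InvConv s u a)
    (hs : ∀ n, (s n).IsHermitian) (n : ℕ) :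
    (H2b q s n).PosDef ↔ (H1b q u n).PosDef := by
  rw [← IsUnit.posDef_star_right_conjugate_iff (h.isUnit_comp_lowerToeplitz n) (x := H1b q u n),
    star_comp_lowerToeplitz hs, H1b_eq_comp, H2b_eq_comp, ← map_mul, ← map_mul]
  have : lowerToeplitz n s * hankel n u * (lowerToeplitz n s)ᵀ
      = hankel n fun k => s (k + 1) := by
    ext1 i j
    rw [lowerToeplitz_mul_hankel_mul_apply,
      toeplitz_hankel_toeplitz_entry s u a h.zero_mul h.right h.left]
    rfl
  rw [this]

theorem InvConv.posDef_H1b_succ_iff {s u : ℕ → Mat q} {a : Mat q} (h : InvConv s u a)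
    (hs : ∀ n, (s n).IsHermitian) (n : ℕ) :
    (H1b q s (n + 1)).PosDef ↔ (s 0).PosDef ∧ (H2b q u n).PosDef := by
  let e : Fin q ⊕ Fin n × Fin q ≃ Fin (n + 1) × Fin q :=
    { toFun := Sum.elim (fun a => (0, a)) (fun p => (p.1.succ, p.2))
      invFun := fun p => Fin.cases (Sum.inl p.2) (fun i => Sum.inr (i, p.2)) p.1
      left_inv := by rintro (a | ⟨i, a⟩) <;> simp
      right_inv := by
        rintro ⟨i, a⟩
        refine Fin.cases ?_ (fun i => ?_) i <;> simp }
  let B : Matrix (Fin q) (Fin n × Fin q) ℂ := of fun a p => s ((p.1 : ℕ) + 1) a p.2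
  have hB : (H1b q s (n + 1)).submatrix e e
      = fromBlocks (s 0) B Bᴴ (H1b q (fun k => s (k + 2)) n) := by
    ext (a | ⟨i, a⟩) (b | ⟨j, b⟩)
    · simp [H1b, e]
    · simp [H1b, e, B]
    · simp only [H1b, e, B, submatrix_apply, of_apply, fromBlocks_apply₂₁, conjTranspose_apply,
        Equiv.coe_fn_mk, Sum.elim_inl, Sum.elim_inr]
      rw [(hs _).apply]
      simp
    · simp only [H1b, e, submatrix_apply, of_apply, fromBlocks_apply₂₂,
        Equiv.coe_fn_mk, Sum.elim_inr, Fin.val_succ]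
      rw [show (i : ℕ) + 1 + (j + 1) = i + j + 2 by ring]
  have h1 : (H1b q s (n + 1)).PosDef ↔ ((H1b q s (n + 1)).submatrix e e).PosDef := by
    refine ⟨fun h => h.submatrix e.injective, fun h => ?_⟩
    have := h.submatrix e.symm.injective
    simpa using this
  rw [h1, hB, posDef_fromBlocks_iff]
  refine and_congr_right fun _ => ?_
  rw [← IsUnit.posDef_star_right_conjugate_iff (h.isUnit_comp_lowerToeplitz n) (x := H2b q u n),
    star_comp_lowerToeplitz hs, H2b_eq_comp, ← map_mul, ← map_mul]
  have ha : (s 0)⁻¹ = a := inv_eq_left_inv h.zero_mul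
  have : H1b q (fun k => s (k + 2)) n - Bᴴ * (s 0)⁻¹ * B
      = compRingEquiv (Fin n) (Fin q) ℂ
        (lowerToeplitz n s * (hankel n fun k => u (k + 1)) * (lowerToeplitz n s)ᵀ) := by
    ext ⟨i, k⟩ ⟨j, l⟩
    rw [compRingEquiv_apply, comp_apply, lowerToeplitz_mul_hankel_mul_apply,
      toeplitz_hankel_succ_toeplitz_entry s u a h.zero_mul h.right h.left, ha]
    rw [Matrix.sub_apply, Matrix.sub_apply]
    congr 1
    rw [mul_apply, mul_apply]
    refine Finset.sum_congr rfl fun x _ => ?_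
    rw [mul_apply, mul_apply]
    simp only [B, conjTranspose_apply, of_apply, (hs _).apply]
  rw [this]

end BlockHankel

section MatrixPowerSeries

variable {q : ℕ}

/-- Matrices of formal power series. -/
abbrev MatSeries (q : ℕ) := Matrix (Fin q) (Fin q) (PowerSeries ℂ)

/-- The matrix of `n`-th coefficients of a matrix of power series. -/
def matCoeff (n : ℕ) (S : MatSeries q) : Mat q := S.map (PowerSeries.coeff n)

/-- A constant matrix as a matrix of power series. -/
def seriesC (a : Mat q) : MatSeries q := (PowerSeries.C (R := ℂ)).mapMatrix a

theorem matSeries_ext {S T : MatSeries q} (h : ∀ n, matCoeff n S = matCoeff n T) : S = T := by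
  ext i j n
  exact congrFun (congrFun (h n) i) j

theorem matCoeff_mul (n : ℕ) (S T : MatSeries q) :
    matCoeff n (S * T) = ∑ i ∈ Finset.range (n + 1), matCoeff (n - i) S * matCoeff i T := by
  ext i j
  rw [Matrix.sum_apply i j]
  simp only [matCoeff, map_apply, mul_apply, map_sum, PowerSeries.coeff_mul]
  conv_rhs => rw [Finset.sum_comm]
  refine Finset.sum_congr rfl fun x _ => ?_
  rw [Finset.Nat.sum_antidiagonal_eq_sum_range_succ_mk, ← Finset.sum_range_reflect]
  refine Finset.sum_congr rfl fun l hl => ?_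
  rw [Finset.mem_range] at hl
  simp only
  congr 3; omega

theorem matCoeff_sub (n : ℕ) (S T : MatSeries q) :
    matCoeff n (S - T) = matCoeff n S - matCoeff n T := by
  ext i j; simp [matCoeff]

theorem matCoeff_zero_X_smul (S : MatSeries q) :
    matCoeff 0 ((PowerSeries.X : PowerSeries ℂ) • S) = 0 := by
  ext i j; simp [matCoeff]

theorem matCoeff_succ_X_smul (n : ℕ) (S : MatSeries q) :
    matCoeff (n + 1) ((PowerSeries.X : PowerSeries ℂ) • S) = matCoeff n S := by
  ext i j; simp [matCoeff, PowerSeries.coeff_succ_X_mul]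

theorem matCoeff_X_pow_smul_of_lt {n k : ℕ} (h : n < k) (S : MatSeries q) :
    matCoeff n ((PowerSeries.X : PowerSeries ℂ) ^ k • S) = 0 := by
  ext i j; simp [matCoeff, PowerSeries.coeff_X_pow_mul', h]

theorem matCoeff_zero_seriesC (a : Mat q) : matCoeff 0 (seriesC a) = a := by
  ext i j; simp [matCoeff, seriesC]

theorem matCoeff_succ_seriesC (n : ℕ) (a : Mat q) : matCoeff (n + 1) (seriesC a) = 0 := by
  ext i j; simp [matCoeff, seriesC]

theorem matCoeff_mul_seriesC (n : ℕ) (S : MatSeries q) (a : Mat q) :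
    matCoeff n (S * seriesC a) = matCoeff n S * a := by
  ext i j; simp [matCoeff, seriesC, mul_apply]

theorem matCoeff_seriesC_mul (n : ℕ) (S : MatSeries q) (a : Mat q) :
    matCoeff n (seriesC a * S) = a * matCoeff n S := by
  ext i j; simp [matCoeff, seriesC, mul_apply]

theorem matCoeff_one (n : ℕ) : matCoeff n (1 : MatSeries q) = if n = 0 then 1 else 0 := by
  ext i j
  rcases eq_or_ne n 0 with rfl | hn <;> by_cases hij : i = j <;>
    simp_all [matCoeff, one_apply, PowerSeries.coeff_one]

theorem isUnit_matSeries {S : MatSeries q} (h : (matCoeff 0 S).det ≠ 0) : IsUnit S := by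
  rw [isUnit_iff_isUnit_det, PowerSeries.isUnit_iff_constantCoeff, RingHom.map_det]
  rw [isUnit_iff_ne_zero]
  convert h using 2
  ext i j
  simp [matCoeff]

theorem invConv_of_mul_eq_one {S U : MatSeries q} {a : Mat q}
    (h : S * (seriesC a - (PowerSeries.X : PowerSeries ℂ) • U) = 1) :
    InvConv (fun n => matCoeff n S) (fun n => matCoeff n U) a := by
  have h' : (seriesC a - (PowerSeries.X : PowerSeries ℂ) • U) * S = 1 := mul_eq_one_comm.1 h
  rw [mul_sub, mul_smul_comm] at h
  rw [sub_mul, smul_mul_assoc] at h'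
  refine ⟨?_, ?_, fun n => ?_, fun n => ?_⟩
  · have := congrArg (matCoeff 0) h
    rwa [matCoeff_sub, matCoeff_mul_seriesC, matCoeff_zero_X_smul, sub_zero, matCoeff_one,
      if_pos rfl] at this
  · have := congrArg (matCoeff 0) h'
    rwa [matCoeff_sub, matCoeff_seriesC_mul, matCoeff_zero_X_smul, sub_zero, matCoeff_one,
      if_pos rfl] at this
  · have := congrArg (matCoeff (n + 1)) h
    rw [matCoeff_sub, matCoeff_mul_seriesC, matCoeff_succ_X_smul, matCoeff_one,
      if_neg n.succ_ne_zero, sub_eq_zero, matCoeff_mul] at this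
    exact this.symm
  · have := congrArg (matCoeff (n + 1)) h'
    rw [matCoeff_sub, matCoeff_seriesC_mul, matCoeff_succ_X_smul, matCoeff_one,
      if_neg n.succ_ne_zero, sub_eq_zero, matCoeff_mul, ← Finset.sum_range_reflect] at this
    rw [this]
    refine Finset.sum_congr rfl fun i hi => ?_
    rw [Finset.mem_range] at hi
    congr 2
    omega

/-- All coefficients of the matrix power series are Hermitian. -/
def IsHermSeries (S : MatSeries q) : Prop := ∀ n, (matCoeff n S).IsHermitian

/-- Coefficientwise conjugate transpose. -/
def seriesStar (S : MatSeries q) : MatSeries q :=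
  ((PowerSeries.map (starRingEnd ℂ)).mapMatrix S)ᵀ

theorem matCoeff_seriesStar (n : ℕ) (S : MatSeries q) :
    matCoeff n (seriesStar S) = (matCoeff n S)ᴴ := by
  ext i j; simp [matCoeff, seriesStar]

theorem isHermSeries_iff {S : MatSeries q} : IsHermSeries S ↔ seriesStar S = S := by
  refine ⟨fun h => matSeries_ext fun n => ?_, fun h n => ?_⟩
  · rw [matCoeff_seriesStar, (h n).eq]
  · rw [IsHermitian, ← matCoeff_seriesStar, h]

theorem IsHermSeries.of_mul_eq_one {S T : MatSeries q} (hT : IsHermSeries T) (h : S * T = 1) :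
    IsHermSeries S := by
  rw [isHermSeries_iff] at hT ⊢
  have h1 : seriesStar T * seriesStar S = 1 := by
    rw [seriesStar, seriesStar, ← transpose_mul, ← map_mul, h, map_one, transpose_one]
  rw [hT] at h1
  exact (left_inv_eq_right_inv h h1).symm

theorem isHermSeries_seriesC_sub {a : Mat q} {U : MatSeries q} :
    IsHermSeries (seriesC a - (PowerSeries.X : PowerSeries ℂ) • U) ↔
      a.IsHermitian ∧ IsHermSeries U := by
  constructor
  · refine fun h => ⟨?_, fun n => ?_⟩
    · have := h 0
      rwa [matCoeff_sub, matCoeff_zero_seriesC, matCoeff_zero_X_smul, sub_zero] at this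
    · have := h (n + 1)
      rw [matCoeff_sub, matCoeff_succ_seriesC, matCoeff_succ_X_smul, zero_sub] at this
      simpa using this.neg
  · rintro ⟨ha, hU⟩ (_ | n)
    · rwa [matCoeff_sub, matCoeff_zero_seriesC, matCoeff_zero_X_smul, sub_zero]
    · rw [matCoeff_sub, matCoeff_succ_seriesC, matCoeff_succ_X_smul, zero_sub]
      exact (hU n).neg

theorem exists_eq_seriesC_sub (T : MatSeries q) :
    ∃ U : MatSeries q, T = seriesC (matCoeff 0 T) - (PowerSeries.X : PowerSeries ℂ) • U := by
  refine ⟨of fun i j => PowerSeries.mk fun n => -PowerSeries.coeff (n + 1) (T i j),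
    matSeries_ext fun n => ?_⟩
  rcases n with _ | n
  · rw [matCoeff_sub, matCoeff_zero_seriesC, matCoeff_zero_X_smul, sub_zero]
  · rw [matCoeff_sub, matCoeff_succ_seriesC, matCoeff_succ_X_smul, zero_sub]
    ext i j
    simp [matCoeff]

/-- Both block Hankel matrices of size `n` of the coefficients are positive definite. -/
def StieltjesPos (n : ℕ) (S : MatSeries q) : Prop :=
  (H1b q (fun k => matCoeff k S) n).PosDef ∧ (H2b q (fun k => matCoeff k S) n).PosDef

theorem stieltjesPos_succ_iff {n : ℕ} {S U V : MatSeries q} {a b : Mat q}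
    (hS : IsHermSeries S) (hU : IsHermSeries U)
    (h1 : S * (seriesC a - (PowerSeries.X : PowerSeries ℂ) • U) = 1)
    (h2 : U * (seriesC b - (PowerSeries.X : PowerSeries ℂ) • V) = 1) :
    StieltjesPos (n + 1) S ↔
      (matCoeff 0 S).PosDef ∧ (matCoeff 0 U).PosDef ∧ StieltjesPos n V := by
  have e1 := invConv_of_mul_eq_one h1
  have e2 := invConv_of_mul_eq_one h2
  rw [StieltjesPos, StieltjesPos, e1.posDef_H1b_succ_iff hS, e1.posDef_H2b_iff hS,
    e2.posDef_H1b_succ_iff hU, e2.posDef_H2b_iff hU]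
  tauto

/-- One step of the continued fraction expansion, with error term. -/
theorem continuedFraction_step {S U V p r R : MatSeries q} {c d : Mat q} {k : ℕ}
    (h1 : (seriesC c - (PowerSeries.X : PowerSeries ℂ) • U) * S = 1)
    (h2 : (seriesC d - (PowerSeries.X : PowerSeries ℂ) • V) * U = 1)
    (h : p * V - r = (PowerSeries.X : PowerSeries ℂ) ^ k • R) :
    ((p * seriesC d - (PowerSeries.X : PowerSeries ℂ) • r) * seriesC c
        - (PowerSeries.X : PowerSeries ℂ) • p) * S - (p * seriesC d - (PowerSeries.X : PowerSeries ℂ) • r)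
      = (PowerSeries.X : PowerSeries ℂ) ^ (k + 2) • (R * U * S) := by
  rw [sub_mul, smul_mul_assoc, sub_eq_iff_eq_add] at h1 h2
  generalize hw : p * seriesC d - (PowerSeries.X : PowerSeries ℂ) • r = w
  have hwU : w * U - p = (PowerSeries.X : PowerSeries ℂ) • ((p * V - r) * U) := by
    rw [← hw, sub_mul, mul_assoc, h2, mul_add, mul_one, smul_mul_assoc, sub_mul, smul_sub,
      mul_smul_comm, mul_assoc]
    abel
  have : (w * seriesC c - (PowerSeries.X : PowerSeries ℂ) • p) * S - w
      = (PowerSeries.X : PowerSeries ℂ) • ((w * U - p) * S) := by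
    rw [sub_mul, mul_assoc, h1, mul_add, mul_one, smul_mul_assoc, sub_mul, smul_sub,
      mul_smul_comm, mul_assoc]
    abel
  rw [this, hwU, h, smul_mul_assoc, smul_mul_assoc, smul_mul_assoc, smul_smul, smul_smul,
    pow_add]
  congr 1
  ring

end MatrixPowerSeries

section ContinuedFraction

variable {q : ℕ}

/-- Matrices of polynomials. -/
abbrev MatPoly (q : ℕ) := Matrix (Fin q) (Fin q) (Polynomial ℂ)

/-- A constant matrix as a matrix of polynomials. -/
def polyC (a : Mat q) : MatPoly q := (Polynomial.C (R := ℂ)).mapMatrix a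

/-- The left denominator and numerator of the continued fraction
`(c - X (d - X F)⁻¹)⁻¹`, built from the innermost level `F = 1⁻¹ * 0`. -/
def cfPoly (c d : ℕ → Mat q) : ℕ → MatPoly q × MatPoly q
  | 0 => (1, 0)
  | n + 1 =>
    let N := (cfPoly c d n).1 * polyC (d n) - (Polynomial.X : Polynomial ℂ) • (cfPoly c d n).2
    (N * polyC (c n) - (Polynomial.X : Polynomial ℂ) • (cfPoly c d n).1, N)

theorem cfPoly_congr {c d c' d' : ℕ → Mat q} {n : ℕ} (hc : ∀ k < n, c k = c' k)
    (hd : ∀ k < n, d k = d' k) : cfPoly c d n = cfPoly c' d' n := by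
  induction n with
  | zero => rfl
  | succ n ih =>
    rw [cfPoly, cfPoly, ih (fun k hk => hc k (by omega)) (fun k hk => hd k (by omega)),
      hc n (by omega), hd n (by omega)]

/-- Matrices of polynomials as matrices of power series. -/
def toSeries : MatPoly q →+* MatSeries q :=
  (Polynomial.coeToPowerSeries.ringHom (R := ℂ)).mapMatrix

theorem toSeries_polyC (a : Mat q) : toSeries (polyC a) = seriesC a := by
  ext i j : 2; simp [toSeries, polyC, seriesC]

theorem toSeries_smul (f : Polynomial ℂ) (M : MatPoly q) :
    toSeries (f • M) = (f : PowerSeries ℂ) • toSeries M := by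
  ext i j : 2; simp [toSeries]

theorem matCoeff_zero_toSeries_cfPoly_fst (c d : ℕ → Mat q) (n : ℕ)
    (hc : ∀ k < n, (c k).PosDef) (hd : ∀ k < n, (d k).PosDef) :
    (matCoeff 0 (toSeries (cfPoly c d n).1)).det ≠ 0 := by
  induction n with
  | zero => simp [cfPoly, matCoeff_one]
  | succ n ih =>
    simp only [cfPoly, map_sub, map_mul, toSeries_polyC, toSeries_smul, Polynomial.coe_X]
    rw [matCoeff_sub, matCoeff_zero_X_smul, sub_zero, matCoeff_mul_seriesC, matCoeff_sub,
      matCoeff_zero_X_smul, sub_zero, matCoeff_mul_seriesC, det_mul, det_mul]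
    exact mul_ne_zero (mul_ne_zero (ih (fun k hk => hc k (by omega))
      (fun k hk => hd k (by omega))) (hd n (by omega)).det_pos.ne')
      (hc n (by omega)).det_pos.ne'

/-- A continued fraction with positive definite parameters has a Stieltjes positive expansion. -/
theorem exists_series_of_posDef (c d : ℕ → Mat q) (n : ℕ)
    (hc : ∀ k < n, (c k).PosDef) (hd : ∀ k < n, (d k).PosDef) :
    ∃ S : MatSeries q, IsHermSeries S ∧ StieltjesPos n S ∧
      toSeries (cfPoly c d n).1 * S = toSeries (cfPoly c d n).2 := by
  induction n with
  | zero =>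
    refine ⟨0, fun n => by simp [matCoeff], ⟨?_, ?_⟩, by simp [cfPoly]⟩
    · exact ⟨Subsingleton.elim _ _, fun x hx => (hx (Subsingleton.elim _ _)).elim⟩
    · exact ⟨Subsingleton.elim _ _, fun x hx => (hx (Subsingleton.elim _ _)).elim⟩
  | succ n ih =>
    obtain ⟨V, hV, hVpos, hVeq⟩ := ih (fun k hk => hc k (by omega)) (fun k hk => hd k (by omega))
    have hcn := hc n (by omega)
    have hdn := hd n (by omega)
    have unit (a : Mat q) (ha : a.PosDef) (W : MatSeries q) :
        IsUnit (seriesC a - (PowerSeries.X : PowerSeries ℂ) • W) := by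
      refine isUnit_matSeries ?_
      rw [matCoeff_sub, matCoeff_zero_seriesC, matCoeff_zero_X_smul, sub_zero]
      exact ha.det_pos.ne'
    obtain ⟨U, hU⟩ := (unit _ hdn V).exists_left_inv
    obtain ⟨S, hS⟩ := (unit _ hcn U).exists_left_inv
    have hUh : IsHermSeries U :=
      (isHermSeries_seriesC_sub.2 ⟨hdn.isHermitian, hV⟩).of_mul_eq_one hU
    have hSh : IsHermSeries S :=
      (isHermSeries_seriesC_sub.2 ⟨hcn.isHermitian, hUh⟩).of_mul_eq_one hS
    refine ⟨S, hSh, (stieltjesPos_succ_iff hSh hUh hS hU).2 ⟨?_, ?_, hVpos⟩, ?_⟩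
    · rw [← inv_eq_left_inv (invConv_of_mul_eq_one hS).mul_zero]
      exact hcn.inv
    · rw [← inv_eq_left_inv (invConv_of_mul_eq_one hU).mul_zero]
      exact hdn.inv
    · have h := continuedFraction_step (k := 0) (R := 0) (mul_eq_one_comm.1 hS)
        (mul_eq_one_comm.1 hU) (by rw [hVeq, sub_self, smul_zero])
      simp only [zero_mul, smul_zero] at h
      simp only [cfPoly, map_sub, map_mul, toSeries_polyC, toSeries_smul, Polynomial.coe_X]
      exact sub_eq_zero.1 h

/-- A Stieltjes positive series agrees with a positive definite continued fraction to high
order. -/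
theorem exists_posDef_of_stieltjesPos (n : ℕ) :
    ∀ S : MatSeries q, IsHermSeries S → StieltjesPos n S →
      ∃ c d : ℕ → Mat q, (∀ k < n, (c k).PosDef) ∧ (∀ k < n, (d k).PosDef) ∧
        ∃ R, toSeries (cfPoly c d n).1 * S - toSeries (cfPoly c d n).2
          = (PowerSeries.X : PowerSeries ℂ) ^ (2 * n) • R := by
  induction n with
  | zero => exact fun S _ _ => ⟨0, 0, by simp, by simp, S, by simp [cfPoly]⟩
  | succ n ih =>
    intro S hS hpos
    have step (W : MatSeries q) (hW : IsHermSeries W) (h0 : (matCoeff 0 W).PosDef) :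
        ∃ (a : Mat q) (Z : MatSeries q), a.PosDef ∧ IsHermSeries Z ∧
          W * (seriesC a - (PowerSeries.X : PowerSeries ℂ) • Z) = 1 := by
      obtain ⟨T, hT⟩ := (isUnit_matSeries h0.det_pos.ne').exists_left_inv
      obtain ⟨Z, hZ⟩ := exists_eq_seriesC_sub T
      have hT' := hW.of_mul_eq_one hT
      rw [hZ] at hT hT'
      have h1 := mul_eq_one_comm.1 hT
      refine ⟨_, Z, ?_, (isHermSeries_seriesC_sub.1 hT').2, h1⟩
      rw [← inv_eq_right_inv (invConv_of_mul_eq_one h1).mul_zero]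
      exact h0.inv
    have h0 : (matCoeff 0 S).PosDef :=
      hpos.1.submatrix (e := fun a => ((0 : Fin (n + 1)), a)) (fun a b h => (Prod.ext_iff.1 h).2)
    obtain ⟨a, U, ha, hU, hSU⟩ := step S hS h0
    have hU0 : (matCoeff 0 U).PosDef :=
      (((invConv_of_mul_eq_one hSU).posDef_H2b_iff hS (n + 1)).1 hpos.2).submatrix
        (e := fun a => ((0 : Fin (n + 1)), a)) (fun a b h => (Prod.ext_iff.1 h).2)
    obtain ⟨b, V, hb, hV, hUV⟩ := step U hU hU0
    obtain ⟨c, d, hc, hd, R, hR⟩ :=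
      ih V hV ((stieltjesPos_succ_iff hS hU hSU hUV).1 hpos).2.2
    refine ⟨Function.update c n a, Function.update d n b, ?_, ?_, R * U * S, ?_⟩
    · intro k hk
      rcases eq_or_ne k n with rfl | hkn
      · simpa using ha
      · rw [Function.update_of_ne hkn]
        exact hc k (by omega)
    · intro k hk
      rcases eq_or_ne k n with rfl | hkn
      · simpa using hb
      · rw [Function.update_of_ne hkn]
        exact hd k (by omega)
    · have hcf : cfPoly (Function.update c n a) (Function.update d n b) n = cfPoly c d n :=
        cfPoly_congr (fun k hk => Function.update_of_ne hk.ne _ _)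
          (fun k hk => Function.update_of_ne hk.ne _ _)
      simp only [cfPoly, hcf, Function.update_self, map_sub, map_mul, toSeries_polyC,
        toSeries_smul, Polynomial.coe_X]
      exact continuedFraction_step (mul_eq_one_comm.1 hSU) (mul_eq_one_comm.1 hUV) hR

end ContinuedFraction

section Evaluation

variable {q : ℕ}

/-- Evaluation of a matrix of polynomials. -/
def evalMat (y : ℂ) : MatPoly q →+* Mat q := (Polynomial.evalRingHom y).mapMatrix

theorem evalMat_polyC (y : ℂ) (a : Mat q) : evalMat y (polyC a) = a := by
  ext i j; simp [evalMat, polyC]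

theorem evalMat_smul (y : ℂ) (f : Polynomial ℂ) (M : MatPoly q) :
    evalMat y (f • M) = f.eval y • evalMat y M := by
  ext i j; simp [evalMat]

theorem eq_zero_of_infinite_evalMat {M : MatPoly q} {Y : Set ℂ} (hY : Y.Infinite)
    (h : ∀ y ∈ Y, evalMat y M = 0) : M = 0 := by
  refine Matrix.ext fun i j => ?_
  refine Polynomial.eq_zero_of_infinite_isRoot _ (hY.mono fun y hy => ?_)
  simpa [evalMat] using congrFun (congrFun (h y hy) i) j

/-- The polynomial in `y = -1/z` with coefficients `(-1)^j B_j`, for `j < N`. -/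
def revPoly (N : ℕ) (B : ℕ → Mat q) : MatPoly q :=
  ∑ j ∈ Finset.range N, (-Polynomial.X : Polynomial ℂ) ^ j • polyC (B j)

theorem evalMat_revPoly (N : ℕ) (B : ℕ → Mat q) (y : ℂ) :
    evalMat y (revPoly N B) = ∑ j ∈ Finset.range N, (-y) ^ j • B j := by
  simp [revPoly, map_sum, evalMat_smul, evalMat_polyC]

theorem smul_evalMat_revPoly {N K : ℕ} (hN : N ≤ K + 1) (B : ℕ → Mat q) {z : ℂ} (hz : z ≠ 0) :
    z ^ K • evalMat (-z⁻¹) (revPoly N B) = ∑ j ∈ Finset.range N, z ^ (K - j) • B j := by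
  rw [evalMat_revPoly, Finset.smul_sum]
  refine Finset.sum_congr rfl fun j hj => ?_
  rw [Finset.mem_range] at hj
  rw [smul_smul, neg_neg, inv_pow, pow_sub₀ z hz (by omega)]

theorem matCoeff_toSeries_revPoly (n N : ℕ) (B : ℕ → Mat q) :
    matCoeff n (toSeries (revPoly N B)) = if n < N then (-1 : ℂ) ^ n • B n else 0 := by
  ext i k
  have h : (revPoly N B) i k
      = ∑ j ∈ Finset.range N, Polynomial.C ((-1) ^ j * B j i k) * Polynomial.X ^ j := by
    rw [revPoly, Matrix.sum_apply]
    refine Finset.sum_congr rfl fun j _ => ?_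
    rw [neg_pow]
    simp only [polyC, Matrix.smul_apply, RingHom.mapMatrix_apply, map_apply, smul_eq_mul, map_mul,
      map_pow, map_neg, map_one]
    ring
  have h2 : matCoeff n (toSeries (revPoly N B)) i k = ((revPoly N B) i k).coeff n := by
    simp [matCoeff, toSeries]
  rw [h2, h, Polynomial.finsetSum_coeff]
  simp only [Polynomial.coeff_C_mul, Polynomial.coeff_X_pow, mul_ite, mul_one, mul_zero,
    Finset.sum_ite_eq, Finset.mem_range]
  split_ifs <;> simp

/-- All entries of a matrix of polynomials have degree at most `k`. -/
def MatDegLE (M : MatPoly q) (k : ℕ) : Prop := ∀ i j, (M i j).natDegree ≤ k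

theorem MatDegLE.mul {M N : MatPoly q} {k l : ℕ} (hM : MatDegLE M k) (hN : MatDegLE N l) :
    MatDegLE (M * N) (k + l) := fun i j => by
  rw [mul_apply]
  exact Polynomial.natDegree_sum_le_of_forall_le _ _
    fun x _ => Polynomial.natDegree_mul_le_of_le (hM i x) (hN x j)

theorem MatDegLE.sub {M N : MatPoly q} {k : ℕ} (hM : MatDegLE M k) (hN : MatDegLE N k) :
    MatDegLE (M - N) k := fun i j =>
  Polynomial.natDegree_sub_le_of_le (hM i j) (hN i j) |>.trans (max_self k).le

theorem MatDegLE.smul {M : MatPoly q} {k l : ℕ} {f : Polynomial ℂ} (hf : f.natDegree ≤ l)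
    (hM : MatDegLE M k) : MatDegLE (f • M) (l + k) := fun i j =>
  Polynomial.natDegree_mul_le_of_le hf (hM i j)

theorem MatDegLE.mono {M : MatPoly q} {k l : ℕ} (hM : MatDegLE M k) (h : k ≤ l) :
    MatDegLE M l := fun i j => (hM i j).trans h

theorem matDegLE_polyC (a : Mat q) : MatDegLE (polyC a) 0 := fun i j => by
  simp [polyC]

theorem matDegLE_revPoly {N k : ℕ} (h : N ≤ k + 1) (B : ℕ → Mat q) :
    MatDegLE (revPoly N B) k := fun i j => by
  rw [revPoly, Matrix.sum_apply]
  refine Polynomial.natDegree_sum_le_of_forall_le _ _ fun l hl => ?_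
  rw [Finset.mem_range] at hl
  have h1 : ((-Polynomial.X : Polynomial ℂ) ^ l).natDegree ≤ l := by
    simp
  exact (MatDegLE.smul h1 (matDegLE_polyC (B l))).mono (by omega) i j

theorem matDegLE_cfPoly (c d : ℕ → Mat q) (n : ℕ) :
    MatDegLE (cfPoly c d n).1 n ∧
      MatDegLE ((Polynomial.X : Polynomial ℂ) • (cfPoly c d n).2) n := by
  induction n with
  | zero =>
    refine ⟨fun i j => ?_, fun i j => by simp [cfPoly]⟩
    by_cases h : i = j <;> simp [cfPoly, one_apply, h]
  | succ n ih =>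
    have h1 := (ih.1.mul (matDegLE_polyC (d n))).sub ih.2
    have hX : (Polynomial.X : Polynomial ℂ).natDegree ≤ 1 := Polynomial.natDegree_X_le
    refine ⟨((h1.mul (matDegLE_polyC (c n))).mono (by omega)).sub
      ((MatDegLE.smul hX ih.1).mono (by omega)), (MatDegLE.smul hX h1).mono (by omega)⟩

theorem eq_zero_of_matDegLE {M : MatPoly q} {k : ℕ} {R : MatSeries q}
    (hM : MatDegLE ((Polynomial.X : Polynomial ℂ) • M) k)
    (h : toSeries M = (PowerSeries.X : PowerSeries ℂ) ^ k • R) : M = 0 := by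
  refine Matrix.ext fun i j => Polynomial.ext fun n => ?_
  rcases lt_or_ge n k with hn | hn
  · have h1 := congrFun (congrFun (congrArg (matCoeff n) h) i) j
    rw [matCoeff_X_pow_smul_of_lt hn] at h1
    simpa [matCoeff, toSeries] using h1
  · have h1 := hM i j
    have h2 := Polynomial.coeff_eq_zero_of_natDegree_lt (lt_of_le_of_lt h1 (Nat.lt_succ_of_le hn))
    simpa using h2

/-- The continued fraction denominators and numerators as functions of `z`. -/
def cfFun (c d : ℕ → Mat q) (z : ℂ) : ℕ → Mat q × Mat q
  | 0 => (1, 0)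
  | n + 1 =>
    let N := (cfFun c d z n).1 * d n + (cfFun c d z n).2
    (z • (N * c n) + (cfFun c d z n).1, N)

theorem continuous_cfFun (c d : ℕ → Mat q) (n : ℕ) :
    Continuous (fun z => (cfFun c d z n).1) ∧ Continuous (fun z => (cfFun c d z n).2) := by
  induction n with
  | zero => exact ⟨continuous_const, continuous_const⟩
  | succ n ih =>
    have h : Continuous fun z => (cfFun c d z n).1 * d n + (cfFun c d z n).2 :=
      (ih.1.matrix_mul continuous_const).add ih.2
    exact ⟨(continuous_id.smul (h.matrix_mul continuous_const)).add ih.1, h⟩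

theorem cfFun_eq_evalMat (c d : ℕ → Mat q) {z : ℂ} (hz : z ≠ 0) (n : ℕ) :
    z ^ n • evalMat (-z⁻¹) (cfPoly c d n).1 = (cfFun c d z n).1 ∧
      z ^ n • evalMat (-z⁻¹) (cfPoly c d n).2 = z • (cfFun c d z n).2 := by
  induction n with
  | zero => simp [cfPoly, cfFun]
  | succ n ih =>
    generalize hp : evalMat (-z⁻¹) (cfPoly c d n).1 = p at ih
    generalize hr : evalMat (-z⁻¹) (cfPoly c d n).2 = r at ih
    have h2 : z ^ n • r = z • (cfFun c d z n).2 := ih.2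
    have hN : z ^ n • (p * d n + z⁻¹ • r) = (cfFun c d z n).1 * d n + (cfFun c d z n).2 := by
      rw [smul_add, ← smul_mul_assoc, ih.1, smul_comm, h2, smul_smul, inv_mul_cancel₀ hz,
        one_smul]
    simp only [cfPoly, cfFun, map_sub, map_mul, evalMat_smul, evalMat_polyC, hp, hr,
      Polynomial.eval_X, neg_smul, sub_neg_eq_add]
    rw [← hN, ← ih.1]
    constructor
    · rw [smul_add, pow_succ', mul_smul, mul_smul, smul_mul_assoc, smul_comm (z ^ n) z⁻¹ p,
        smul_smul z z⁻¹, mul_inv_cancel₀ hz, one_smul]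
    · rw [pow_succ', mul_smul]

theorem wEven_cfFun {m : ℕ} {c d c' d' : ℕ → Mat q} {z : ℂ}
    (hc : ∀ j < m, c' j = c (m - 1 - j)) (hd : ∀ j < m, d' j = d (m - 1 - j))
    (hdu : ∀ k < m, (d k).PosDef)
    (h1 : ∀ j < m, IsUnit (wEven q m c d j z).det)
    (h2 : ∀ j, j + 1 < m → IsUnit (d (m - 2 - j) + (wEven q m c d j z)⁻¹).det) (j : ℕ)
    (hj : j < m) :
    IsUnit (cfFun c' d' z (j + 1)).1.det ∧
      (cfFun c' d' z (j + 1)).2 = (cfFun c' d' z (j + 1)).1 * (wEven q m c d j z)⁻¹ := by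
  have finish (p r w : Mat q) (hr : IsUnit r.det) (hw : IsUnit w.det) (h : p = r * w) :
      IsUnit p.det ∧ r = p * w⁻¹ := by
    rw [h, det_mul, mul_nonsing_inv_cancel_right _ _ hw]
    exact ⟨hr.mul hw, rfl⟩
  induction j with
  | zero =>
    have hd0 : IsUnit (d (m - 1)).det := (isUnit_iff_isUnit_det _).1 (hdu _ (by omega)).isUnit
    refine finish _ _ _ ?_ (h1 0 hj) ?_
    · simpa [cfFun, hd 0 hj] using hd0
    · simp only [cfFun, wEven, hc 0 hj, hd 0 hj, Nat.sub_zero, one_mul, add_zero]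
      rw [mul_add, mul_nonsing_inv _ hd0, mul_smul_comm]
  | succ j ih =>
    obtain ⟨hp, hr⟩ := ih (by omega)
    have hu := h2 j hj
    have e : m - 1 - (j + 1) = m - 2 - j := by omega
    have hN : (cfFun c' d' z (j + 1 + 1)).2
        = (cfFun c' d' z (j + 1)).1 * (d (m - 2 - j) + (wEven q m c d j z)⁻¹) := by
      rw [mul_add, ← hr, ← e, ← hd _ hj]
      rfl
    refine finish _ _ _ ?_ (h1 _ hj) ?_
    · rw [hN, det_mul]
      exact hp.mul hu
    · have : (cfFun c' d' z (j + 1 + 1)).1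
          = z • ((cfFun c' d' z (j + 1 + 1)).2 * c (m - 2 - j)) + (cfFun c' d' z (j + 1)).1 := by
        rw [← e, ← hc _ hj]
        rfl
      rw [this, wEven, mul_add, mul_smul_comm]
      congr 1
      rw [hN, mul_nonsing_inv_cancel_right _ _ hu]

theorem posDef_wEven {m : ℕ} {c d : ℕ → Mat q} (hc : ∀ k < m, (c k).PosDef)
    (hd : ∀ k < m, (d k).PosDef) {t : ℝ} (ht : 0 < t) (j : ℕ) (hj : j < m) :
    (wEven q m c d j t).PosDef := by
  have ht' : (0 : ℂ) < t := by exact_mod_cast ht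
  induction j with
  | zero => exact ((hc _ (by omega)).smul ht').add (hd _ (by omega)).inv
  | succ j ih =>
    exact ((hc _ (by omega)).smul ht').add ((hd _ (by omega)).add (ih (by omega)).inv).inv

theorem hEven_eq_evalMat (m : ℕ) (A : ℕ → Mat q) {z : ℂ} (hz : z ≠ 0) :
    hEven q m A z = z ^ m • evalMat (-z⁻¹) (revPoly (m + 1) fun j => A (2 * j)) := by
  rw [smul_evalMat_revPoly le_rfl _ hz, hEven]

theorem gEven_eq_evalMat (m : ℕ) (A : ℕ → Mat q) {z : ℂ} (hz : z ≠ 0) :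
    gEven q m A z = z ^ (m - 1) • evalMat (-z⁻¹) (revPoly m fun j => A (2 * j + 1)) := by
  rw [smul_evalMat_revPoly (by omega) _ hz, gEven]

theorem markovEven_polynomial {m : ℕ} (hm : 1 ≤ m) {A s : ℕ → Mat q} (hM : MarkovEven q m A s) :
    ∃ r : MatPoly q, revPoly m (fun j => A (2 * j + 1))
      - revPoly (2 * m) (fun j => (-1 : ℂ) ^ j • s j) * revPoly (m + 1) (fun j => A (2 * j))
      = (Polynomial.X : Polynomial ℂ) ^ (2 * m) • r := by
  obtain ⟨B, hB⟩ := hM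
  refine ⟨revPoly m fun k => B (m - 1 - k), sub_eq_zero.1 ?_⟩
  refine eq_zero_of_infinite_evalMat (Set.finite_singleton (0 : ℂ)).infinite_compl fun y hy => ?_
  have hy0 : y ≠ 0 := by simpa using hy
  obtain ⟨z, hz, rfl⟩ : ∃ z : ℂ, z ≠ 0 ∧ y = -z⁻¹ :=
    ⟨-y⁻¹, by simpa using hy0, by simp⟩
  have h := hB z
  have hS : ∑ j ∈ Finset.range (2 * m), ((-1 : ℂ) ^ j * z ^ (2 * m - 1 - j)) • s j
      = z ^ (2 * m - 1) • evalMat (-z⁻¹) (revPoly (2 * m) fun j => (-1 : ℂ) ^ j • s j) := by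
    rw [smul_evalMat_revPoly (by omega) _ hz]
    refine Finset.sum_congr rfl fun j _ => ?_
    rw [smul_smul, mul_comm]
  have hR : ∑ k ∈ Finset.range m, z ^ k • B k
      = z ^ (m - 1) • evalMat (-z⁻¹) (revPoly m fun k => B (m - 1 - k)) := by
    rw [smul_evalMat_revPoly (by omega) _ hz, ← Finset.sum_range_reflect]
  rw [hS, hR, hEven_eq_evalMat m A hz, gEven_eq_evalMat m A hz, smul_mul_smul_comm, smul_smul,
    ← pow_add, ← pow_add, show 2 * m - 1 + m = 2 * m + (m - 1) by omega, ← smul_sub, pow_add,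
    mul_comm, mul_smul] at h
  have h' := smul_right_injective _ (pow_ne_zero (m - 1) hz) h
  rw [map_sub, map_sub, map_mul, evalMat_smul, Polynomial.eval_pow, Polynomial.eval_X, ← h',
    smul_smul, ← mul_pow, neg_mul, inv_mul_cancel₀ hz, Even.neg_pow (even_two_mul m), one_pow,
    one_smul, sub_self]

theorem stieltjesPos_iff_of_matCoeff_eq {m : ℕ} {S : MatSeries q} {s : ℕ → Mat q}
    (h : ∀ j < 2 * m, matCoeff j S = s j) :
    StieltjesPos m S ↔ (H1b q s m).PosDef ∧ (H2b q s m).PosDef := by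
  have h1 : H1b q (fun k => matCoeff k S) m = H1b q s m := by
    ext ⟨i, a⟩ ⟨j, b⟩
    simp only [H1b, of_apply]
    rw [h _ (by omega)]
  have h2 : H2b q (fun k => matCoeff k S) m = H2b q s m := by
    ext ⟨i, a⟩ ⟨j, b⟩
    simp only [H2b, of_apply]
    rw [h _ (by omega)]
  rw [StieltjesPos, h1, h2]

theorem matCoeff_toSeries_revPoly_neg_one_pow {m j : ℕ} (s : ℕ → Mat q) (hj : j < m) :
    matCoeff j (toSeries (revPoly m fun j => (-1 : ℂ) ^ j • s j)) = s j := by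
  rw [matCoeff_toSeries_revPoly, if_pos hj, smul_smul, ← mul_pow]
  simp

theorem isHTMEven_of_posDef {m : ℕ} (hm : 1 ≤ m) {A s : ℕ → Mat q}
    (hherm : ∀ j < 2 * m, (s j).IsHermitian) (hM : MarkovEven q m A s)
    (h1 : (H1b q s m).PosDef) (h2 : (H2b q s m).PosDef) :
    IsHTMEven q m (hEven q m A) (gEven q m A) := by
  obtain ⟨r, hr⟩ := markovEven_polynomial hm hM
  set sP := revPoly (2 * m) (fun j => (-1 : ℂ) ^ j • s j) with hsP
  set gP := revPoly m (fun j => A (2 * j + 1)) with hgP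
  set hP := revPoly (m + 1) (fun j => A (2 * j)) with hhP
  have hcoeff : ∀ j < 2 * m, matCoeff j (toSeries sP) = s j := fun j hj =>
    matCoeff_toSeries_revPoly_neg_one_pow s hj
  have hS : IsHermSeries (toSeries sP) := by
    intro n
    rcases lt_or_ge n (2 * m) with hn | hn
    · rw [hcoeff n hn]
      exact hherm n hn
    · rw [hsP, matCoeff_toSeries_revPoly, if_neg (by omega)]
      exact isHermitian_zero
  obtain ⟨c, d, hc, hd, R, hR⟩ := exists_posDef_of_stieltjesPos m _ hS
    ((stieltjesPos_iff_of_matCoeff_eq hcoeff).2 ⟨h1, h2⟩)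
  have key : (cfPoly c d m).1 * gP = (cfPoly c d m).2 * hP := by
    refine sub_eq_zero.1 (eq_zero_of_matDegLE (k := 2 * m)
      (R := R * toSeries hP + toSeries ((cfPoly c d m).1 * r)) ?_ ?_)
    · have hX : (Polynomial.X : Polynomial ℂ).natDegree ≤ 1 := Polynomial.natDegree_X_le
      obtain ⟨d1, d2⟩ := matDegLE_cfPoly c d m
      rw [smul_sub, ← mul_smul_comm, ← smul_mul_assoc]
      refine (((d1.mul (MatDegLE.smul hX (matDegLE_revPoly (k := m - 1) (by omega) _))).mono
        (by omega))).sub ((d2.mul (matDegLE_revPoly (k := m) le_rfl _)).mono (by omega))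
    · have e : (cfPoly c d m).1 * gP - (cfPoly c d m).2 * hP
          = ((cfPoly c d m).1 * sP - (cfPoly c d m).2) * hP
            + (Polynomial.X : Polynomial ℂ) ^ (2 * m) • ((cfPoly c d m).1 * r) := by
        rw [← mul_smul_comm, ← hr]
        noncomm_ring
      rw [e, map_add, map_mul, map_sub, map_mul toSeries _ sP, hR, toSeries_smul,
        Polynomial.coe_pow, Polynomial.coe_X, smul_mul_assoc, smul_add]
  have hne : ∀ z : ℂ, z ≠ 0 →
      (cfFun c d z m).1 * gEven q m A z = (cfFun c d z m).2 * hEven q m A z := by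
    intro z hz
    obtain ⟨e1, e2⟩ := cfFun_eq_evalMat c d hz m
    have e3 := congrArg (evalMat (-z⁻¹)) key
    rw [map_mul, map_mul] at e3
    refine smul_right_injective _ hz ?_
    simp only
    rw [← smul_mul_assoc z (cfFun c d z m).2, ← e2, ← e1, hEven_eq_evalMat m A hz,
      gEven_eq_evalMat m A hz, smul_mul_smul_comm, smul_mul_smul_comm, smul_smul, ← hgP, ← hhP,
      e3, ← pow_add, ← pow_succ', ← pow_add]
    congr 2
    omega
  have hall : (fun z => (cfFun c d z m).1 * gEven q m A z)
      = fun z => (cfFun c d z m).2 * hEven q m A z := by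
    have hg : Continuous (gEven q m A) :=
      continuous_finsetSum _ fun j _ => (continuous_pow _).smul continuous_const
    have hh : Continuous (hEven q m A) :=
      continuous_finsetSum _ fun j _ => (continuous_pow _).smul continuous_const
    refine Continuous.ext_on (dense_compl_singleton (0 : ℂ))
      ((continuous_cfFun c d m).1.matrix_mul hg) ((continuous_cfFun c d m).2.matrix_mul hh)
      fun z hz => hne z (by simpa using hz)
  refine ⟨fun k => c (m - 1 - k), fun k => d (m - 1 - k), fun k hk => hc _ (by omega),
    fun k hk => hd _ (by omega), fun z hz u1 u2 => ?_⟩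
  have hrev (f : ℕ → Mat q) : ∀ j < m, f j = f (m - 1 - (m - 1 - j)) := fun j hj => by
    congr 1; omega
  obtain ⟨hu, hq⟩ := wEven_cfFun (hrev c) (hrev d) (fun k hk => hd _ (by omega)) u1 u2 (m - 1)
    (by omega)
  rw [Nat.sub_add_cancel hm] at hu hq
  have h := congrFun hall z
  rw [hq, mul_assoc] at h
  have h' := congrArg (fun M => (cfFun c d z m).1⁻¹ * M) h
  simp only [nonsing_inv_mul_cancel_left _ _ hu] at h'
  rw [h', mul_nonsing_inv_cancel_right _ _ (isUnit_iff_ne_zero.2 hz)]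

theorem posDef_of_isHTMEven {m : ℕ} (hm : 1 ≤ m) {A s : ℕ → Mat q}
    (hA0 : (A 0).det ≠ 0) (hM : MarkovEven q m A s)
    (hf : IsHTMEven q m (hEven q m A) (gEven q m A)) :
    (H1b q s m).PosDef ∧ (H2b q s m).PosDef := by
  obtain ⟨r, hr⟩ := markovEven_polynomial hm hM
  set sP := revPoly (2 * m) (fun j => (-1 : ℂ) ^ j • s j) with hsP
  set gP := revPoly m (fun j => A (2 * j + 1)) with hgP
  set hP := revPoly (m + 1) (fun j => A (2 * j)) with hhP
  obtain ⟨c', d', hc', hd', hcd⟩ := hf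
  let c : ℕ → Mat q := fun j => c' (m - 1 - j)
  let d : ℕ → Mat q := fun j => d' (m - 1 - j)
  have hc : ∀ k < m, (c k).PosDef := fun k hk => hc' _ (by omega)
  have hd : ∀ k < m, (d k).PosDef := fun k hk => hd' _ (by omega)
  obtain ⟨S, hS, hpos, hPS⟩ := exists_series_of_posDef c d m hc hd
  have hhP0 : evalMat 0 hP = A 0 := by
    rw [hhP, evalMat_revPoly, Finset.sum_range_succ']
    simp
  have hdet : hP.det ≠ 0 := by
    intro h0
    apply hA0
    rw [← hhP0, evalMat, ← RingHom.map_det, h0, map_zero]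
  have key : (cfPoly c d m).1 * gP - (cfPoly c d m).2 * hP = 0 := by
    have hinf : (Set.range fun n : ℕ => -(((n : ℝ) + 1 : ℝ) : ℂ)⁻¹).Infinite := by
      refine Set.infinite_range_of_injective fun a b hab => ?_
      simpa using hab
    refine (smul_eq_zero.1 (eq_zero_of_infinite_evalMat (M := hP.det • _) hinf ?_)).resolve_left
      hdet
    rintro _ ⟨n, rfl⟩
    simp only
    set t : ℝ := (n : ℝ) + 1 with ht
    have ht0 : 0 < t := by positivity
    have hz : (t : ℂ) ≠ 0 := by exact_mod_cast ht0.ne'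
    rw [evalMat_smul]
    by_cases hev : Polynomial.eval (-(t : ℂ)⁻¹) hP.det = 0
    · rw [hev, zero_smul]
    have hdz : (hEven q m A t).det ≠ 0 := by
      rw [hEven_eq_evalMat m A hz, det_smul]
      refine mul_ne_zero (pow_ne_zero _ (pow_ne_zero _ hz)) ?_
      rwa [evalMat, ← RingHom.map_det]
    have isU {M : Mat q} (h : M.PosDef) : IsUnit M.det := (isUnit_iff_isUnit_det _).1 h.isUnit
    have u1 : ∀ j < m, IsUnit (wEven q m c' d' j t).det := fun j hj =>
      isU (posDef_wEven hc' hd' ht0 j hj)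
    have u2 : ∀ j, j + 1 < m → IsUnit (d' (m - 2 - j) + (wEven q m c' d' j t)⁻¹).det :=
      fun j hj => isU ((hd' _ (by omega)).add (posDef_wEven hc' hd' ht0 j (by omega)).inv)
    have hgh := hcd t hdz u1 u2
    obtain ⟨-, hq⟩ := wEven_cfFun (c' := c) (d' := d) (fun _ _ => rfl) (fun _ _ => rfl) hd' u1 u2
      (m - 1) (by omega)
    rw [Nat.sub_add_cancel hm, ← hgh, ← mul_assoc] at hq
    have h := congrArg (fun M => M * hEven q m A t) hq
    simp only [nonsing_inv_mul_cancel_right _ _ (isUnit_iff_ne_zero.2 hdz)] at h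
    obtain ⟨e1, e2⟩ := cfFun_eq_evalMat c d hz m
    have h' := congrArg (fun M => (t : ℂ) • M) h
    rw [← smul_mul_assoc, ← e2, ← e1, hEven_eq_evalMat m A hz,
      gEven_eq_evalMat m A hz, smul_mul_smul_comm, smul_mul_smul_comm, smul_smul, ← hgP, ← hhP,
      ← pow_add, ← pow_add, ← pow_succ', show m + (m - 1) + 1 = m + m by omega] at h'
    have h'' := smul_right_injective _ (pow_ne_zero (m + m) hz) h'
    rw [map_sub, map_mul, map_mul, h'', sub_self, smul_zero]
  have hU : IsUnit (toSeries (cfPoly c d m).1) :=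
    isUnit_matSeries (matCoeff_zero_toSeries_cfPoly_fst c d m hc hd)
  have hH : IsUnit (toSeries hP) := by
    refine isUnit_matSeries ?_
    rw [hhP, matCoeff_toSeries_revPoly, if_pos (by omega)]
    simpa using hA0
  obtain ⟨Ui, hUi⟩ := hU.exists_left_inv
  obtain ⟨Hi, hHi⟩ := hH.exists_right_inv
  have hdiff : S - toSeries sP
      = (PowerSeries.X : PowerSeries ℂ) ^ (2 * m) • (toSeries r * Hi) := by
    have e := congrArg toSeries key
    rw [map_sub, map_mul, map_mul, map_zero, ← hPS, mul_assoc, ← mul_sub] at e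
    have e' := congrArg (fun M => Ui * M) e
    simp only [mul_zero] at e'
    rw [← mul_assoc, hUi, one_mul] at e'
    have e2 := congrArg toSeries hr
    rw [map_sub, map_mul, toSeries_smul, Polynomial.coe_pow, Polynomial.coe_X,
      sub_eq_zero.1 e', ← sub_mul] at e2
    rw [← smul_mul_assoc, ← e2, mul_assoc, hHi, mul_one]
  refine (stieltjesPos_iff_of_matCoeff_eq (S := S) fun j hj => ?_).1 hpos
  have h := congrArg (matCoeff j) hdiff
  rw [matCoeff_sub, matCoeff_X_pow_smul_of_lt hj, hsP,
    matCoeff_toSeries_revPoly_neg_one_pow s hj] at h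
  exact sub_eq_zero.1 h

end Evaluation

theorem stmt_3 (q m : ℕ) (hq : 1 ≤ q) (hm : 1 ≤ m) (A s : ℕ → Mat q)
    (hA0 : (A 0).det ≠ 0) (hherm : ∀ j < 2 * m, (s j).IsHermitian)
    (hM : MarkovEven q m A s) :
    IsHTMEven q m (hEven q m A) (gEven q m A) ↔
      (H1b q s m).PosDef ∧ (H2b q s m).PosDef := by
  exact ⟨posDef_of_isHTMEven hm hA0 hM, fun h => isHTMEven_of_posDef hm hherm hM h.1 h.2⟩

end
end
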